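/- arXiv:2312.08312 — 6 statements merged into one kernel-verified Lean document; each statement's English description precedes it below -/
import Mathlib

section
/- Let (H, H*) be a factorized A2-Leonard pair on D with basis (X, Y; X*, Y*), with eigenvalues t_0, …, t_N of X and θ*_0, …, θ*_N of Y* as in condition (viii). Then for all integers 0 ≤ x ≤ N and 0 ≤ j ≤ N, the dimension of the subspace E_x E*_j V equals 1 if x + j ≤ N and equals 0 if x + j > N. -/
/-- The domain `D = {(x,y) : x + y ≤ N}`. -/
def domD (N : ℕ) : Set (ℕ × ℕ) := {p | p.1 + p.2 ≤ N}

/-- `A₂`-adjacency of two points of `ℕ × ℕ`: their difference lies in the root system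
`A₂ = {(0,0), (1,-1), (1,0), (0,1), (-1,1), (-1,0), (0,-1)}`. -/
def A2adj (p p' : ℕ × ℕ) : Prop :=
  (((p.1 : ℤ) - p'.1, (p.2 : ℤ) - p'.2) : ℤ × ℤ) ∈
    ({(0, 0), (1, -1), (1, 0), (0, 1), (-1, 1), (-1, 0), (0, -1)} : Set (ℤ × ℤ))

/-- A common eigenspace of a subspace `H` of `End(V)`: a nonzero subspace of the form
`⋂_{A ∈ H} ker (A - χ(A) id)` for some linear functional `χ` on `H`. -/
def IsCommonEigenspace {V : Type*} [AddCommGroup V] [Module ℂ V]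
    (H : Submodule ℂ (Module.End ℂ V)) (U : Submodule ℂ V) : Prop :=
  U ≠ ⊥ ∧ ∃ χ : H →ₗ[ℂ] ℂ,
    U = ⨅ A : H, LinearMap.ker ((A : Module.End ℂ V) - χ A • (1 : Module.End ℂ V))

/-- A factorized `A₂`-Leonard pair on the domain `D`, together with a basis
`(X, Y; X*, Y*)`: conditions (i)–(vii) of the definition of an `A₂`-Leonard pair
and the additional conditions (viii)–(xi). -/
structure FactorizedA2LeonardPair (N : ℕ) (V : Type*) [AddCommGroup V] [Module ℂ V]
    [FiniteDimensional ℂ V] where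
  /-- the subspace `H` of `End(V)` -/
  H : Submodule ℂ (Module.End ℂ V)
  /-- the subspace `H*` of `End(V)` -/
  Hs : Submodule ℂ (Module.End ℂ V)
  /-- first basis element of `H` -/
  X : Module.End ℂ V
  /-- second basis element of `H` -/
  Y : Module.End ℂ V
  /-- first basis element of `H*` -/
  Xs : Module.End ℂ V
  /-- second basis element of `H*` -/
  Ys : Module.End ℂ V
  /-- the common eigenspaces `V_λ` of `H` -/
  Vsub : ℕ × ℕ → Submodule ℂ V
  /-- the common eigenspaces `V*_λ` of `H*` -/
  Vssub : ℕ × ℕ → Submodule ℂ V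
  /-- the bilinear form of condition (vii) -/
  B : V →ₗ[ℂ] V →ₗ[ℂ] ℂ
  /-- the eigenvalues `t_x` of `X` -/
  t : ℕ → ℂ
  /-- the eigenvalues `θ*_j` of `Y*` -/
  θs : ℕ → ℂ
  /-- `(X, Y)` is a basis of `H` -/
  basisH : X ∈ H ∧ Y ∈ H ∧ H = Submodule.span ℂ {X, Y}
  /-- `(X*, Y*)` is a basis of `H*` -/
  basisHs : Xs ∈ Hs ∧ Ys ∈ Hs ∧ Hs = Submodule.span ℂ {Xs, Ys}
  /-- (i): `H` is two-dimensional -/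
  dimH : Module.finrank ℂ H = 2
  /-- (i): the elements of `H` are diagonalizable -/
  diagH : ∀ A ∈ H, (⨆ μ : ℂ, Module.End.eigenspace A μ) = ⊤
  /-- (i): the elements of `H` mutually commute -/
  commH : ∀ A ∈ H, ∀ A' ∈ H, A * A' = A' * A
  /-- (ii): `H*` is two-dimensional -/
  dimHs : Module.finrank ℂ Hs = 2
  /-- (ii): the elements of `H*` are diagonalizable -/
  diagHs : ∀ A ∈ Hs, (⨆ μ : ℂ, Module.End.eigenspace A μ) = ⊤
  /-- (ii): the elements of `H*` mutually commute -/
  commHs : ∀ A ∈ Hs, ∀ A' ∈ Hs, A * A' = A' * A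
  /-- (iii): `V_λ` is a common eigenspace of `H` for `λ ∈ D` -/
  eigV : ∀ p ∈ domD N, IsCommonEigenspace H (Vsub p)
  /-- (iii): `λ ↦ V_λ` is injective on `D` -/
  injV : ∀ p ∈ domD N, ∀ p' ∈ domD N, Vsub p = Vsub p' → p = p'
  /-- (iii): every common eigenspace of `H` is of the form `V_λ` for some `λ ∈ D` -/
  surjV : ∀ U : Submodule ℂ V, IsCommonEigenspace H U → ∃ p ∈ domD N, Vsub p = U
  /-- (iii): `H* V_λ ⊆ Σ_{χ adj λ} V_χ` -/
  adjV : ∀ p ∈ domD N, ∀ A ∈ Hs,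
    Submodule.map A (Vsub p) ≤ ⨆ χ : {χ : ℕ × ℕ // χ ∈ domD N ∧ A2adj χ p}, Vsub χ
  /-- (iv): `V*_λ` is a common eigenspace of `H*` for `λ ∈ D` -/
  eigVs : ∀ p ∈ domD N, IsCommonEigenspace Hs (Vssub p)
  /-- (iv): `λ ↦ V*_λ` is injective on `D` -/
  injVs : ∀ p ∈ domD N, ∀ p' ∈ domD N, Vssub p = Vssub p' → p = p'
  /-- (iv): every common eigenspace of `H*` is of the form `V*_λ` for some `λ ∈ D` -/
  surjVs : ∀ U : Submodule ℂ V, IsCommonEigenspace Hs U → ∃ p ∈ domD N, Vssub p = U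
  /-- (iv): `H V*_λ ⊆ Σ_{χ adj λ} V*_χ` -/
  adjVs : ∀ p ∈ domD N, ∀ A ∈ H,
    Submodule.map A (Vssub p) ≤ ⨆ χ : {χ : ℕ × ℕ // χ ∈ domD N ∧ A2adj χ p}, Vssub χ
  /-- (v): irreducibility -/
  irred : ∀ W : Submodule ℂ V, (∀ A ∈ H, Submodule.map A W ≤ W) →
    (∀ A ∈ Hs, Submodule.map A W ≤ W) → W = ⊥ ∨ W = ⊤
  /-- (vi): `dim V_λ = 1` -/
  dimV : ∀ p ∈ domD N, Module.finrank ℂ (Vsub p) = 1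
  /-- (vi): `dim V*_λ = 1` -/
  dimVs : ∀ p ∈ domD N, Module.finrank ℂ (Vssub p) = 1
  /-- (vii): the bilinear form is symmetric -/
  symmB : ∀ v w, B v w = B w v
  /-- (vii): the bilinear form is non-degenerate -/
  nondegB : ∀ v, (∀ w, B v w = 0) → v = 0
  /-- (vii): `⟨V_λ, V_χ⟩ = 0` for `λ ≠ χ` -/
  orthoV : ∀ p ∈ domD N, ∀ p' ∈ domD N, p ≠ p' → ∀ v ∈ Vsub p, ∀ w ∈ Vsub p', B v w = 0
  /-- (vii): `⟨V*_λ, V*_χ⟩ = 0` for `λ ≠ χ` -/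
  orthoVs : ∀ p ∈ domD N, ∀ p' ∈ domD N, p ≠ p' → ∀ v ∈ Vssub p, ∀ w ∈ Vssub p', B v w = 0
  /-- (viii): the eigenvalues `t_0, …, t_N` are pairwise distinct -/
  t_distinct : ∀ x ≤ N, ∀ x' ≤ N, x ≠ x' → t x ≠ t x'
  /-- (viii): the eigenvalues `θ*_0, …, θ*_N` are pairwise distinct -/
  θs_distinct : ∀ j ≤ N, ∀ j' ≤ N, j ≠ j' → θs j ≠ θs j'
  /-- (viii): `(X - t_x id) V_{(x,y)} = 0` -/
  eigX : ∀ p ∈ domD N, ∀ v ∈ Vsub p, X v = t p.1 • v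
  /-- (viii): `(Y* - θ*_j id) V*_{(i,j)} = 0` -/
  eigYs : ∀ p ∈ domD N, ∀ v ∈ Vssub p, Ys v = θs p.2 • v
  /-- (ix): `[X, Y*] = 0` -/
  commXYs : X * Ys = Ys * X
  /-- (x): every common eigenspace of the pair `{X, Y*}` has dimension one -/
  commonDim : ∀ a b : ℂ,
    LinearMap.ker (X - a • (1 : Module.End ℂ V)) ⊓
        LinearMap.ker (Ys - b • (1 : Module.End ℂ V)) ≠ ⊥ →
    Module.finrank ℂ
      ↥(LinearMap.ker (X - a • (1 : Module.End ℂ V)) ⊓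
        LinearMap.ker (Ys - b • (1 : Module.End ℂ V))) = 1
  /-- (xi): `⟨V*_{(i+1,j)}, X V*_{(i,j)}⟩ ≠ 0` and `⟨V*_{(i,j)}, X V*_{(i+1,j)}⟩ ≠ 0` -/
  irr1 : ∀ i j : ℕ, (i, j) ∈ domD N → (i + 1, j) ∈ domD N →
    (∃ v ∈ Vssub (i + 1, j), ∃ w ∈ Vssub (i, j), B v (X w) ≠ 0) ∧
    (∃ v ∈ Vssub (i, j), ∃ w ∈ Vssub (i + 1, j), B v (X w) ≠ 0)
  /-- (xi): `⟨V_{(x,y+1)}, Y* V_{(x,y)}⟩ ≠ 0` and `⟨V_{(x,y)}, Y* V_{(x,y+1)}⟩ ≠ 0` -/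
  irr2 : ∀ x y : ℕ, (x, y) ∈ domD N → (x, y + 1) ∈ domD N →
    (∃ v ∈ Vsub (x, y + 1), ∃ w ∈ Vsub (x, y), B v (Ys w) ≠ 0) ∧
    (∃ v ∈ Vsub (x, y), ∃ w ∈ Vsub (x, y + 1), B v (Ys w) ≠ 0)

/-- The spectral projector `E_x` of `X`. -/
noncomputable def projE {N : ℕ} {V : Type*} [AddCommGroup V] [Module ℂ V]
    [FiniteDimensional ℂ V] (F : FactorizedA2LeonardPair N V) (x : ℕ) : Module.End ℂ V :=
  Polynomial.aeval F.X (∏ x' ∈ (Finset.range (N + 1)).erase x,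
    (Polynomial.C (F.t x - F.t x')⁻¹ * (Polynomial.X - Polynomial.C (F.t x'))))

/-- The spectral projector `E*_j` of `Y*`. -/
noncomputable def projEs {N : ℕ} {V : Type*} [AddCommGroup V] [Module ℂ V]
    [FiniteDimensional ℂ V] (F : FactorizedA2LeonardPair N V) (j : ℕ) : Module.End ℂ V :=
  Polynomial.aeval F.Ys (∏ j' ∈ (Finset.range (N + 1)).erase j,
    (Polynomial.C (F.θs j - F.θs j')⁻¹ * (Polynomial.X - Polynomial.C (F.θs j'))))

/-- If an endomorphism is diagonalizable, its maximal generalized eigenspaces are its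
eigenspaces. -/
theorem Module.End.maxGenEigenspace_eq_eigenspace_of_iSup_eq_top {K V : Type*} [Field K]
    [AddCommGroup V] [Module K V] (f : Module.End K V) (h : ⨆ μ, f.eigenspace μ = ⊤) (μ : K) :
    f.maxGenEigenspace μ = f.eigenspace μ := by
  have hle : ∀ ν, f.eigenspace ν ≤ f.maxGenEigenspace ν := fun ν =>
    (f.genEigenspace ν).monotone le_top
  have hd : Disjoint (⨆ ν, ⨆ _ : ν ≠ μ, f.eigenspace ν) (f.maxGenEigenspace μ) :=
    ((f.independent_genEigenspace ⊤ μ).symm).mono_left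
      (iSup_mono fun ν => iSup_mono fun _ => hle ν)
  have hs : f.eigenspace μ ⊔ ⨆ ν, ⨆ _ : ν ≠ μ, f.eigenspace ν = ⊤ := by
    rw [← h]
    exact (iSup_split_single f.eigenspace μ).symm
  have := sup_inf_assoc_of_le (⨆ ν, ⨆ _ : ν ≠ μ, f.eigenspace ν) (hle μ)
  rw [hs, hd.eq_bot, top_inf_eq, sup_bot_eq] at this
  exact this

/-- If the common eigenspaces of a commuting space of diagonalizable endomorphisms are
one-dimensional and are listed without repetition by `U` on `S`, then picking a vector in each
of them gives a basis. -/
theorem exists_basis_of_commonEigenspaces {V ι : Type*} [AddCommGroup V] [Module ℂ V]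
    [FiniteDimensional ℂ V] {H : Submodule ℂ (Module.End ℂ V)} {S : Set ι}
    {U : ι → Submodule ℂ V}
    (diag : ∀ A ∈ H, (⨆ μ : ℂ, Module.End.eigenspace A μ) = ⊤)
    (comm : ∀ A ∈ H, ∀ A' ∈ H, A * A' = A' * A)
    (eig : ∀ p ∈ S, IsCommonEigenspace H (U p))
    (inj : ∀ p ∈ S, ∀ p' ∈ S, U p = U p' → p = p')
    (surj : ∀ W : Submodule ℂ V, IsCommonEigenspace H W → ∃ p ∈ S, U p = W)
    (dim : ∀ p ∈ S, Module.finrank ℂ (U p) = 1) :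
    ∃ b : Module.Basis S ℂ V, ∀ p : S, b p ∈ U p := by
  have hgen : ∀ χ : H → ℂ, ⨅ A : H, (A : Module.End ℂ V).maxGenEigenspace (χ A) =
      ⨅ A : H, LinearMap.ker ((A : Module.End ℂ V) - χ A • (1 : Module.End ℂ V)) := by
    intro χ
    refine iInf_congr fun A => ?_
    rw [Module.End.maxGenEigenspace_eq_eigenspace_of_iSup_eq_top _ (diag A A.2),
      Module.End.eigenspace_def]
  have hmaps : ∀ (i j : H) (φ : ℂ), Set.MapsTo (i : Module.End ℂ V)
      ((j : Module.End ℂ V).maxGenEigenspace φ) ((j : Module.End ℂ V).maxGenEigenspace φ) :=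
    fun i j φ => Module.End.mapsTo_maxGenEigenspace_of_comm (comm j j.2 i i.2) φ
  have hind := Module.End.independent_iInf_maxGenEigenspace_of_forall_mapsTo
    (fun A : H => (A : Module.End ℂ V)) hmaps
  have htop := Module.End.iSup_iInf_maxGenEigenspace_eq_top_of_forall_mapsTo
    (fun A : H => (A : Module.End ℂ V)) hmaps fun A => by
      simp_rw [Module.End.maxGenEigenspace_eq_eigenspace_of_iSup_eq_top _ (diag A A.2)]
      exact diag A A.2
  simp only [hgen] at hind htop
  choose χ hχ using fun p : S => (eig p p.2).2
  have hχinj : Function.Injective fun p : S => (χ p : H → ℂ) := by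
    intro p q hpq
    refine Subtype.ext (inj p p.2 q q.2 ?_)
    rw [hχ p, hχ q]
    exact iInf_congr fun A => by rw [show χ p A = χ q A from congrFun hpq A]
  have hUind : iSupIndep fun p : S => U p := by
    have h := hind.comp hχinj
    have he : (fun p : S => U p) = (fun χ : H → ℂ => ⨅ A : H,
        LinearMap.ker ((A : Module.End ℂ V) - χ A • (1 : Module.End ℂ V))) ∘
          fun p : S => (χ p : H → ℂ) := funext hχ
    rw [he]
    exact h
  have hUtop : ⨆ p : S, U p = ⊤ := by
    rw [eq_top_iff, ← htop]
    refine iSup_le fun φ => ?_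
    by_cases hbot : (⨅ A : H,
        LinearMap.ker ((A : Module.End ℂ V) - φ A • (1 : Module.End ℂ V))) = ⊥
    · rw [hbot]
      exact bot_le
    obtain ⟨v, hv, hv0⟩ := (Submodule.ne_bot_iff _).1 hbot
    have hv' : ∀ A : H, (A : Module.End ℂ V) v = φ A • v := by
      intro A
      have := (Submodule.mem_iInf _).1 hv A
      simpa [sub_eq_zero] using this
    let φ' : H →ₗ[ℂ] ℂ :=
      { toFun := φ
        map_add' := fun A A' => smul_left_injective ℂ hv0 (by
          simp only [add_smul, ← hv']
          simp)
        map_smul' := fun c A => smul_left_injective ℂ hv0 (by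
          simp only [RingHom.id_apply, smul_eq_mul, mul_smul, ← hv']
          simp) }
    obtain ⟨p, hp, hpU⟩ := surj _ ⟨hbot, φ', rfl⟩
    rw [← hpU]
    exact le_iSup (fun p : S => U p) ⟨p, hp⟩
  choose v hv hv0 using fun p : S => (Submodule.ne_bot_iff _).1 (eig p p.2).1
  have hspan : ∀ p : S, U p = Submodule.span ℂ {v p} := fun p =>
    (Submodule.eq_of_le_of_finrank_le ((Submodule.span_singleton_le_iff_mem _ _).2 (hv p))
      (by rw [dim p p.2, finrank_span_singleton (hv0 p)])).symm
  refine ⟨Module.Basis.mk (hUind.linearIndependent _ hv hv0) ?_, fun p => ?_⟩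
  · rw [← hUtop, Submodule.span_range_eq_iSup]
    exact iSup_mono fun p => (hspan p).le
  · rw [Module.Basis.mk_apply]
    exact hv p
/-- The Lagrange interpolation polynomials of distinct eigenvalues, evaluated at an endomorphism
with an eigenbasis, project onto the eigenvectors of the corresponding eigenvalue. -/
theorem aeval_lagrangeBasis_apply_eigenbasis {V : Type*} [AddCommGroup V] [Module ℂ V] {ι : Type*}
    {A : Module.End ℂ V} {t : ℕ → ℂ} {s : Finset ℕ} (ht : Set.InjOn t s) (b : ι → V) (c : ι → ℕ)
    (hc : ∀ i, c i ∈ s) (hA : ∀ i, A (b i) = t (c i) • b i) {x : ℕ} (hx : x ∈ s) (i : ι) :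
    Polynomial.aeval A (Lagrange.basis s t x) (b i) = if c i = x then b i else 0 := by
  have h : ∀ p : Polynomial ℂ, Polynomial.aeval A p (b i) = p.eval (t (c i)) • b i := by
    intro p
    by_cases hb : b i = 0
    · simp [hb]
    · exact Module.End.aeval_apply_of_hasEigenvector ⟨Module.End.mem_eigenspace_iff.2 (hA i), hb⟩
  rw [h]
  split_ifs with hcx
  · rw [hcx, Lagrange.eval_basis_self ht hx, one_smul]
  · rw [Lagrange.eval_basis_of_ne (Ne.symm hcx) (hc i), zero_smul]

/-- An endomorphism that keeps some vectors of a basis and annihilates the others has trace the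
number of vectors kept. -/
theorem trace_eq_card_of_apply_basis {V ι : Type*} [AddCommGroup V] [Module ℂ V] [Fintype ι]
    (b : Module.Basis ι ℂ V) (P : Module.End ℂ V) (c : ι → Prop) [DecidablePred c]
    (h : ∀ i, P (b i) = if c i then b i else 0) :
    LinearMap.trace ℂ V P = ∑ i, if c i then 1 else 0 := by
  classical
  rw [LinearMap.trace_eq_matrix_trace ℂ b, Matrix.trace]
  refine Finset.sum_congr rfl fun i _ => ?_
  rw [Matrix.diag_apply, LinearMap.toMatrix_apply, h]
  split_ifs <;> simp

/-- A `0`-`1` matrix with the row sums and the column sums of a triangular matrix is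
triangular. -/
theorem eq_triangular_of_sum_eq {N : ℕ} {d : ℕ → ℕ → ℕ} (h1 : ∀ x ≤ N, ∀ j ≤ N, d x j ≤ 1)
    (hrow : ∀ x ≤ N, ∑ j ∈ Finset.range (N + 1), d x j =
      ∑ j ∈ Finset.range (N + 1), if x + j ≤ N then 1 else 0)
    (hcol : ∀ j ≤ N, ∑ x ∈ Finset.range (N + 1), d x j =
      ∑ x ∈ Finset.range (N + 1), if x + j ≤ N then 1 else 0)
    {x j : ℕ} (hx : x ≤ N) (hj : j ≤ N) : d x j = if x + j ≤ N then 1 else 0 := by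
  let e : ℕ → ℕ → ℤ := fun x j => (if x + j ≤ N then 1 else 0) - d x j
  have hr : ∀ x ∈ Finset.range (N + 1), ∑ j ∈ Finset.range (N + 1), e x j = 0 := by
    intro x hx
    have := congrArg (Nat.cast : ℕ → ℤ) (hrow x (Finset.mem_range_succ_iff.1 hx))
    simp only [Nat.cast_sum, Nat.cast_ite, Nat.cast_one, Nat.cast_zero] at this
    simp only [e, Finset.sum_sub_distrib, this, sub_self]
  have hc : ∀ j ∈ Finset.range (N + 1), ∑ x ∈ Finset.range (N + 1), e x j = 0 := by
    intro j hj
    have := congrArg (Nat.cast : ℕ → ℤ) (hcol j (Finset.mem_range_succ_iff.1 hj))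
    simp only [Nat.cast_sum, Nat.cast_ite, Nat.cast_one, Nat.cast_zero] at this
    simp only [e, Finset.sum_sub_distrib, this, sub_self]
  have hnn : ∀ x ∈ Finset.range (N + 1), ∀ j ∈ Finset.range (N + 1),
      0 ≤ (2 * ((N : ℤ) - x - j) + 1) * e x j := by
    intro x hx j hj
    have hd := h1 x (Finset.mem_range_succ_iff.1 hx) j (Finset.mem_range_succ_iff.1 hj)
    simp only [e]
    split_ifs with h
    · exact mul_nonneg (by omega) (by omega)
    · exact mul_nonneg_of_nonpos_of_nonpos (by omega) (by omega)
  have hsum : ∑ x ∈ Finset.range (N + 1), ∑ j ∈ Finset.range (N + 1),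
      (2 * ((N : ℤ) - x - j) + 1) * e x j = 0 := by
    have hsplit : ∀ x j : ℕ, (2 * ((N : ℤ) - x - j) + 1) * e x j =
        (2 * ((N : ℤ) - x) + 1) * e x j - 2 * j * e x j := fun x j => by ring
    simp_rw [hsplit, Finset.sum_sub_distrib]
    rw [Finset.sum_comm (f := fun (x j : ℕ) => 2 * (j : ℤ) * e x j)]
    simp_rw [← Finset.mul_sum]
    rw [Finset.sum_eq_zero fun x hx => by rw [hr x hx, mul_zero],
      Finset.sum_eq_zero fun j hj => by rw [hc j hj, mul_zero], sub_zero]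
  have hx' := Finset.mem_range_succ_iff.2 hx
  have hj' := Finset.mem_range_succ_iff.2 hj
  have h0 := (Finset.sum_eq_zero_iff_of_nonneg (hnn x hx')).1
    ((Finset.sum_eq_zero_iff_of_nonneg fun x hx => Finset.sum_nonneg (hnn x hx)).1 hsum x hx')
    j hj'
  have he : e x j = 0 := (mul_eq_zero.1 h0).resolve_left (by omega)
  simp only [e] at he
  split_ifs at he ⊢ <;> omega

/-- For commuting idempotents `P x` and `Q j`, each family summing to the identity, the ranks
of the products `P x * Q j` sum over `j` to the rank of `P x`. -/
theorem sum_finrank_range_mul {V : Type*} [AddCommGroup V] [Module ℂ V] [FiniteDimensional ℂ V]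
    {P : Module.End ℂ V} {Q : ℕ → Module.End ℂ V} {s : Finset ℕ} (hP : IsIdempotentElem P)
    (hQ : ∀ j ∈ s, IsIdempotentElem (Q j)) (hPQ : ∀ j, Commute P (Q j)) (hQ1 : ∑ j ∈ s, Q j = 1) :
    ((∑ j ∈ s, Module.finrank ℂ (LinearMap.range (P * Q j)) : ℕ) : ℂ) =
      LinearMap.trace ℂ V P := by
  rw [Nat.cast_sum]
  calc ∑ j ∈ s, (Module.finrank ℂ (LinearMap.range (P * Q j)) : ℂ)
      = ∑ j ∈ s, LinearMap.trace ℂ V (P * Q j) := Finset.sum_congr rfl fun j hj =>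
        (((LinearMap.isProj_range_iff_isIdempotentElem _).2
          (hP.mul_of_commute (hPQ j) (hQ j hj))).trace).symm
    _ = LinearMap.trace ℂ V P := by rw [← map_sum, ← Finset.mul_sum, hQ1, mul_one]

/-- The Lagrange interpolation polynomials at an endomorphism with an eigenbasis indexed by the
points of `domD N`: idempotents which sum to the identity, are made of eigenvectors, and have the
expected traces. -/
theorem aeval_lagrangeBasis_properties {V : Type*} [AddCommGroup V] [Module ℂ V] {N : ℕ}
    {A : Module.End ℂ V} {t : ℕ → ℂ} (ht : ∀ x ≤ N, ∀ x' ≤ N, x ≠ x' → t x ≠ t x')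
    (b : Module.Basis (domD N) ℂ V) (c : ℕ × ℕ → ℕ) (hc : ∀ p ∈ domD N, c p ≤ N)
    (hA : ∀ p : domD N, A (b p) = t (c p) • b p) :
    (∀ x ≤ N, IsIdempotentElem
      (Polynomial.aeval A (Lagrange.basis (Finset.range (N + 1)) t x))) ∧
    ∑ x ∈ Finset.range (N + 1),
      Polynomial.aeval A (Lagrange.basis (Finset.range (N + 1)) t x) = 1 ∧
    (∀ x ≤ N, A * Polynomial.aeval A (Lagrange.basis (Finset.range (N + 1)) t x) =
      t x • Polynomial.aeval A (Lagrange.basis (Finset.range (N + 1)) t x)) ∧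
    ∀ x ≤ N, LinearMap.trace ℂ V
        (Polynomial.aeval A (Lagrange.basis (Finset.range (N + 1)) t x)) =
      ∑ p ∈ Finset.range (N + 1) ×ˢ Finset.range (N + 1),
        if p.1 + p.2 ≤ N ∧ c p = x then 1 else 0 := by
  have hinj : Set.InjOn t (Finset.range (N + 1)) := by
    intro x hx x' hx' h
    by_contra hne
    exact ht x (by simpa [Nat.lt_succ_iff] using hx) x' (by simpa [Nat.lt_succ_iff] using hx') hne h
  have happ : ∀ x ≤ N, ∀ p,
      Polynomial.aeval A (Lagrange.basis (Finset.range (N + 1)) t x) (b p) =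
        if c p = x then b p else 0 := fun x hx p =>
    aeval_lagrangeBasis_apply_eigenbasis hinj b (fun p => c p)
      (fun p => Finset.mem_range_succ_iff.2 (hc p p.2)) hA (Finset.mem_range_succ_iff.2 hx) p
  refine ⟨fun x hx => b.ext fun p => ?_, b.ext fun p => ?_, fun x hx => b.ext fun p => ?_,
    fun x hx => ?_⟩
  · rw [Module.End.mul_apply, happ x hx]
    split_ifs with h
    · rw [happ x hx, if_pos h]
    · rw [map_zero]
  · rw [LinearMap.sum_apply, Finset.sum_congr rfl fun x hx =>
      happ x (Finset.mem_range_succ_iff.1 hx) p, Finset.sum_ite_eq,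
      if_pos (Finset.mem_range_succ_iff.2 (hc p p.2)), Module.End.one_apply]
  · rw [Module.End.mul_apply, LinearMap.smul_apply, happ x hx]
    split_ifs with h
    · rw [hA, h]
    · rw [map_zero, smul_zero]
  · have hD : ∀ p : ℕ × ℕ, p ∈ (Finset.range (N + 1) ×ˢ Finset.range (N + 1)).filter
        (fun p => p.1 + p.2 ≤ N) ↔ p ∈ domD N := by
      intro p
      simp only [Finset.mem_filter, Finset.mem_product, Finset.mem_range, domD, Set.mem_ofPred_eq]
      omega
    let : Fintype (domD N) := Fintype.ofFinset _ hD
    rw [trace_eq_card_of_apply_basis b _ _ (happ x hx)]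
    simp_rw [ite_and]
    rw [← Finset.sum_filter (fun p : ℕ × ℕ => p.1 + p.2 ≤ N)]
    exact (Finset.sum_subtype _ hD fun p : ℕ × ℕ => if c p = x then (1 : ℂ) else 0).symm

/-- Polynomials in two commuting endomorphisms commute. -/
theorem commute_aeval_aeval {R A : Type*} [CommSemiring R] [Semiring A] [Algebra R A] {a b : A}
    (h : Commute a b) (p q : Polynomial R) :
    Commute (Polynomial.aeval a p) (Polynomial.aeval b q) := by
  rw [Polynomial.aeval_eq_sum_range, Polynomial.aeval_eq_sum_range]
  exact Commute.sum_left _ _ _ fun i _ => Commute.sum_right _ _ _ fun j _ =>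
    ((h.pow_pow i j).smul_left _).smul_right _

/-- Lemma: `dim (E_x E*_j V) = 1` if `x + j ≤ N`, and `0` otherwise. -/
theorem dim_projE_projEs {N : ℕ} (hN : 0 < N) {V : Type*} [AddCommGroup V]
    [Module ℂ V] [FiniteDimensional ℂ V] (F : FactorizedA2LeonardPair N V)
    (x j : ℕ) (hx : x ≤ N) (hj : j ≤ N) :
    Module.finrank ℂ ↥(LinearMap.range (projE F x * projEs F j)) =
      if x + j ≤ N then 1 else 0 := by
  obtain ⟨b, hb⟩ := exists_basis_of_commonEigenspaces F.diagH F.commH F.eigV F.injV F.surjV F.dimV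
  obtain ⟨bs, hbs⟩ :=
    exists_basis_of_commonEigenspaces F.diagHs F.commHs F.eigVs F.injVs F.surjVs F.dimVs
  obtain ⟨hEid, hE1, hEX, hEtr⟩ := aeval_lagrangeBasis_properties F.t_distinct b Prod.fst
    (fun p hp => le_trans (Nat.le_add_right _ _) hp) fun p => F.eigX p p.2 _ (hb p)
  obtain ⟨hEsid, hEs1, hEsY, hEstr⟩ := aeval_lagrangeBasis_properties F.θs_distinct bs Prod.snd
    (fun p hp => le_trans (Nat.le_add_left _ _) hp) fun p => F.eigYs p p.2 _ (hbs p)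
  have hcomm : ∀ x j, Commute (projE F x) (projEs F j) := fun x j =>
    commute_aeval_aeval F.commXYs _ _
  change ∀ x ≤ N, IsIdempotentElem (projE F x) at hEid
  change ∑ x ∈ Finset.range (N + 1), projE F x = 1 at hE1
  change ∀ x ≤ N, F.X * projE F x = F.t x • projE F x at hEX
  change ∀ x ≤ N, LinearMap.trace ℂ V (projE F x) = _ at hEtr
  change ∀ j ≤ N, IsIdempotentElem (projEs F j) at hEsid
  change ∑ j ∈ Finset.range (N + 1), projEs F j = 1 at hEs1
  change ∀ j ≤ N, F.Ys * projEs F j = F.θs j • projEs F j at hEsY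
  change ∀ j ≤ N, LinearMap.trace ℂ V (projEs F j) = _ at hEstr
  refine eq_triangular_of_sum_eq
    (d := fun x j => Module.finrank ℂ (LinearMap.range (projE F x * projEs F j)))
    (fun x hx j hj => ?_) (fun x hx => ?_) (fun j hj => ?_) hx hj
  · have hle : LinearMap.range (projE F x * projEs F j) ≤
        LinearMap.ker (F.X - F.t x • (1 : Module.End ℂ V)) ⊓
          LinearMap.ker (F.Ys - F.θs j • (1 : Module.End ℂ V)) := by
      refine le_inf ?_ ?_
      · rw [LinearMap.range_le_ker_iff, ← Module.End.mul_eq_comp, sub_mul, smul_mul_assoc, one_mul,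
          ← mul_assoc, hEX x hx, smul_mul_assoc, sub_self]
      · rw [LinearMap.range_le_ker_iff, ← Module.End.mul_eq_comp, sub_mul, smul_mul_assoc, one_mul,
          (hcomm x j).eq, ← mul_assoc, hEsY j hj, smul_mul_assoc, sub_self]
    refine (Submodule.finrank_mono hle).trans ?_
    by_cases hbot : LinearMap.ker (F.X - F.t x • (1 : Module.End ℂ V)) ⊓
        LinearMap.ker (F.Ys - F.θs j • (1 : Module.End ℂ V)) = ⊥
    · rw [hbot, finrank_bot]
      exact zero_le_one
    · exact (F.commonDim _ _ hbot).le
  · have h := sum_finrank_range_mul (hEid x hx)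
      (fun j hj => hEsid j (Finset.mem_range_succ_iff.1 hj)) (hcomm x) hEs1
    rw [hEtr x hx, Finset.sum_product_right] at h
    refine Nat.cast_injective (R := ℂ) (h.trans ?_)
    rw [Nat.cast_sum]
    refine Finset.sum_congr rfl fun j _ => ?_
    simp_rw [and_comm, ite_and, Nat.cast_ite, Nat.cast_one, Nat.cast_zero]
    rw [Finset.sum_ite_eq', if_pos (Finset.mem_range_succ_iff.2 hx)]
  · have h := sum_finrank_range_mul (hEsid j hj)
      (fun x hx => hEid x (Finset.mem_range_succ_iff.1 hx)) (fun x => (hcomm x j).symm) hE1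
    rw [hEstr j hj, Finset.sum_product] at h
    have hswap : ∀ x, Module.finrank ℂ (LinearMap.range (projEs F j * projE F x)) =
        Module.finrank ℂ (LinearMap.range (projE F x * projEs F j)) := fun x => by
      rw [(hcomm x j).eq]
    rw [Finset.sum_congr rfl fun x _ => hswap x] at h
    refine Nat.cast_injective (R := ℂ) (h.trans ?_)
    rw [Nat.cast_sum]
    refine Finset.sum_congr rfl fun x _ => ?_
    simp_rw [and_comm, ite_and, Nat.cast_ite, Nat.cast_one, Nat.cast_zero]
    rw [Finset.sum_ite_eq', if_pos (Finset.mem_range_succ_iff.2 hj)]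
end

section
/- Suppose that a pair (H, H*) of two-dimensional subspaces of End(V), together with a basis (X, Y) of H and a basis (X*, Y*) of H*, satisfies conditions (i), (ii), (iii), (iv), (vi), (vii) of the definition of an A2-Leonard pair on D and conditions (viii), (ix), (x), (xi) of the definition of a factorized A2-Leonard pair, but where the irreducibility condition (v) is not assumed. Then condition (v) automatically holds: the only subspaces W of V with H W ⊆ W and H* W ⊆ W are 0 and V. In other words, for a factorized A2-Leonard pair the irreducibility condition (v) is redundant. -/
/-- A factorized `A₂`-Leonard pair on the domain `D`, together with a basis
`(X, Y; X*, Y*)`: conditions (i)–(vii) of the definition of an `A₂`-Leonard pair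
and the additional conditions (viii)–(xi). -/
structure FactorizedA2LeonardPairWithoutIrred (N : ℕ) (V : Type*) [AddCommGroup V] [Module ℂ V]
    [FiniteDimensional ℂ V] where
  /-- the subspace `H` of `End(V)` -/
  H : Submodule ℂ (Module.End ℂ V)
  /-- the subspace `H*` of `End(V)` -/
  Hs : Submodule ℂ (Module.End ℂ V)
  /-- first basis element of `H` -/
  X : Module.End ℂ V
  /-- second basis element of `H` -/
  Y : Module.End ℂ V
  /-- first basis element of `H*` -/
  Xs : Module.End ℂ V
  /-- second basis element of `H*` -/
  Ys : Module.End ℂ V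
  /-- the common eigenspaces `V_λ` of `H` -/
  Vsub : ℕ × ℕ → Submodule ℂ V
  /-- the common eigenspaces `V*_λ` of `H*` -/
  Vssub : ℕ × ℕ → Submodule ℂ V
  /-- the bilinear form of condition (vii) -/
  B : V →ₗ[ℂ] V →ₗ[ℂ] ℂ
  /-- the eigenvalues `t_x` of `X` -/
  t : ℕ → ℂ
  /-- the eigenvalues `θ*_j` of `Y*` -/
  θs : ℕ → ℂ
  /-- `(X, Y)` is a basis of `H` -/
  basisH : X ∈ H ∧ Y ∈ H ∧ H = Submodule.span ℂ {X, Y}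
  /-- `(X*, Y*)` is a basis of `H*` -/
  basisHs : Xs ∈ Hs ∧ Ys ∈ Hs ∧ Hs = Submodule.span ℂ {Xs, Ys}
  /-- (i): `H` is two-dimensional -/
  dimH : Module.finrank ℂ H = 2
  /-- (i): the elements of `H` are diagonalizable -/
  diagH : ∀ A ∈ H, (⨆ μ : ℂ, Module.End.eigenspace A μ) = ⊤
  /-- (i): the elements of `H` mutually commute -/
  commH : ∀ A ∈ H, ∀ A' ∈ H, A * A' = A' * A
  /-- (ii): `H*` is two-dimensional -/
  dimHs : Module.finrank ℂ Hs = 2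
  /-- (ii): the elements of `H*` are diagonalizable -/
  diagHs : ∀ A ∈ Hs, (⨆ μ : ℂ, Module.End.eigenspace A μ) = ⊤
  /-- (ii): the elements of `H*` mutually commute -/
  commHs : ∀ A ∈ Hs, ∀ A' ∈ Hs, A * A' = A' * A
  /-- (iii): `V_λ` is a common eigenspace of `H` for `λ ∈ D` -/
  eigV : ∀ p ∈ domD N, IsCommonEigenspace H (Vsub p)
  /-- (iii): `λ ↦ V_λ` is injective on `D` -/
  injV : ∀ p ∈ domD N, ∀ p' ∈ domD N, Vsub p = Vsub p' → p = p'
  /-- (iii): every common eigenspace of `H` is of the form `V_λ` for some `λ ∈ D` -/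
  surjV : ∀ U : Submodule ℂ V, IsCommonEigenspace H U → ∃ p ∈ domD N, Vsub p = U
  /-- (iii): `H* V_λ ⊆ Σ_{χ adj λ} V_χ` -/
  adjV : ∀ p ∈ domD N, ∀ A ∈ Hs,
    Submodule.map A (Vsub p) ≤ ⨆ χ : {χ : ℕ × ℕ // χ ∈ domD N ∧ A2adj χ p}, Vsub χ
  /-- (iv): `V*_λ` is a common eigenspace of `H*` for `λ ∈ D` -/
  eigVs : ∀ p ∈ domD N, IsCommonEigenspace Hs (Vssub p)
  /-- (iv): `λ ↦ V*_λ` is injective on `D` -/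
  injVs : ∀ p ∈ domD N, ∀ p' ∈ domD N, Vssub p = Vssub p' → p = p'
  /-- (iv): every common eigenspace of `H*` is of the form `V*_λ` for some `λ ∈ D` -/
  surjVs : ∀ U : Submodule ℂ V, IsCommonEigenspace Hs U → ∃ p ∈ domD N, Vssub p = U
  /-- (iv): `H V*_λ ⊆ Σ_{χ adj λ} V*_χ` -/
  adjVs : ∀ p ∈ domD N, ∀ A ∈ H,
    Submodule.map A (Vssub p) ≤ ⨆ χ : {χ : ℕ × ℕ // χ ∈ domD N ∧ A2adj χ p}, Vssub χ
  /-- (vi): `dim V_λ = 1` -/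
  dimV : ∀ p ∈ domD N, Module.finrank ℂ (Vsub p) = 1
  /-- (vi): `dim V*_λ = 1` -/
  dimVs : ∀ p ∈ domD N, Module.finrank ℂ (Vssub p) = 1
  /-- (vii): the bilinear form is symmetric -/
  symmB : ∀ v w, B v w = B w v
  /-- (vii): the bilinear form is non-degenerate -/
  nondegB : ∀ v, (∀ w, B v w = 0) → v = 0
  /-- (vii): `⟨V_λ, V_χ⟩ = 0` for `λ ≠ χ` -/
  orthoV : ∀ p ∈ domD N, ∀ p' ∈ domD N, p ≠ p' → ∀ v ∈ Vsub p, ∀ w ∈ Vsub p', B v w = 0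
  /-- (vii): `⟨V*_λ, V*_χ⟩ = 0` for `λ ≠ χ` -/
  orthoVs : ∀ p ∈ domD N, ∀ p' ∈ domD N, p ≠ p' → ∀ v ∈ Vssub p, ∀ w ∈ Vssub p', B v w = 0
  /-- (viii): the eigenvalues `t_0, …, t_N` are pairwise distinct -/
  t_distinct : ∀ x ≤ N, ∀ x' ≤ N, x ≠ x' → t x ≠ t x'
  /-- (viii): the eigenvalues `θ*_0, …, θ*_N` are pairwise distinct -/
  θs_distinct : ∀ j ≤ N, ∀ j' ≤ N, j ≠ j' → θs j ≠ θs j'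
  /-- (viii): `(X - t_x id) V_{(x,y)} = 0` -/
  eigX : ∀ p ∈ domD N, ∀ v ∈ Vsub p, X v = t p.1 • v
  /-- (viii): `(Y* - θ*_j id) V*_{(i,j)} = 0` -/
  eigYs : ∀ p ∈ domD N, ∀ v ∈ Vssub p, Ys v = θs p.2 • v
  /-- (ix): `[X, Y*] = 0` -/
  commXYs : X * Ys = Ys * X
  /-- (x): every common eigenspace of the pair `{X, Y*}` has dimension one -/
  commonDim : ∀ a b : ℂ,
    LinearMap.ker (X - a • (1 : Module.End ℂ V)) ⊓
        LinearMap.ker (Ys - b • (1 : Module.End ℂ V)) ≠ ⊥ →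
    Module.finrank ℂ
      ↥(LinearMap.ker (X - a • (1 : Module.End ℂ V)) ⊓
        LinearMap.ker (Ys - b • (1 : Module.End ℂ V))) = 1
  /-- (xi): `⟨V*_{(i+1,j)}, X V*_{(i,j)}⟩ ≠ 0` and `⟨V*_{(i,j)}, X V*_{(i+1,j)}⟩ ≠ 0` -/
  irr1 : ∀ i j : ℕ, (i, j) ∈ domD N → (i + 1, j) ∈ domD N →
    (∃ v ∈ Vssub (i + 1, j), ∃ w ∈ Vssub (i, j), B v (X w) ≠ 0) ∧
    (∃ v ∈ Vssub (i, j), ∃ w ∈ Vssub (i + 1, j), B v (X w) ≠ 0)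
  /-- (xi): `⟨V_{(x,y+1)}, Y* V_{(x,y)}⟩ ≠ 0` and `⟨V_{(x,y)}, Y* V_{(x,y+1)}⟩ ≠ 0` -/
  irr2 : ∀ x y : ℕ, (x, y) ∈ domD N → (x, y + 1) ∈ domD N →
    (∃ v ∈ Vsub (x, y + 1), ∃ w ∈ Vsub (x, y), B v (Ys w) ≠ 0) ∧
    (∃ v ∈ Vsub (x, y), ∃ w ∈ Vsub (x, y + 1), B v (Ys w) ≠ 0)

/-- If a subspace `W` is invariant under a set `K` of operators and contains a sum of simultaneous
eigenvectors of `K` with pairwise distinct systems of eigenvalues, then it contains each summand. -/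
theorem mem_of_sum_mem_of_separated {ι V : Type*} [AddCommGroup V] [Module ℂ V]
    {K : Set (Module.End ℂ V)} {χ : ι → Module.End ℂ V → ℂ} {W : Submodule ℂ V}
    (hW : ∀ A ∈ K, ∀ w ∈ W, A w ∈ W) (s : Finset ι)
    (hsep : ∀ i ∈ s, ∀ j ∈ s, i ≠ j → ∃ A ∈ K, χ i A ≠ χ j A)
    (v : ι → V) (hv : ∀ i ∈ s, ∀ A ∈ K, A (v i) = χ i A • v i)
    (hsum : ∑ i ∈ s, v i ∈ W) : ∀ i ∈ s, v i ∈ W := by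
  classical
  induction s using Finset.induction_on generalizing v with
  | empty => simp
  | insert a s ha ih =>
    have key : ∀ i ∈ s, v i ∈ W := by
      intro i hi
      obtain ⟨A, hA, hne⟩ := hsep i (Finset.mem_insert_of_mem hi) a (Finset.mem_insert_self a s)
        (fun h => ha (h ▸ hi))
      have hdiff : ∑ j ∈ s, (χ j A - χ a A) • v j ∈ W := by
        have h := W.sub_mem (hW A hA _ hsum) (W.smul_mem (χ a A) hsum)
        rw [Finset.sum_insert ha, map_add, hv a (Finset.mem_insert_self a s) A hA, smul_add,
          add_sub_add_left_eq_sub, map_sum, Finset.smul_sum, ← Finset.sum_sub_distrib] at h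
        convert h using 2 with j hj
        rw [hv j (Finset.mem_insert_of_mem hj) A hA, sub_smul]
      have hmem := ih (fun i hi j hj => hsep i (Finset.mem_insert_of_mem hi) j
          (Finset.mem_insert_of_mem hj)) (fun j => (χ j A - χ a A) • v j)
        (fun j hj C hC => by
          rw [map_smul, hv j (Finset.mem_insert_of_mem hj) C hC, smul_comm]) hdiff i hi
      exact (W.smul_mem_iff (sub_ne_zero.2 hne)).1 hmem
    intro i hi
    rcases Finset.mem_insert.1 hi with rfl | hi
    · rw [Finset.sum_insert ha] at hsum
      exact (W.add_mem_iff_left (W.sum_mem key)).1 hsum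
    · exact key i hi

/-- A decomposition of `V` into simultaneous eigenlines `U p`, `p ∈ D`, of a set `K` of operators,
with pairwise distinct systems of eigenvalues `χ p`. -/
structure IsEigenlineDecomposition {ι V : Type*} [AddCommGroup V] [Module ℂ V]
    (K : Set (Module.End ℂ V)) (D : Finset ι) (U : ι → Submodule ℂ V)
    (χ : ι → Module.End ℂ V → ℂ) : Prop where
  eig : ∀ p ∈ D, ∀ A ∈ K, ∀ v ∈ U p, A v = χ p A • v
  sep : ∀ p ∈ D, ∀ q ∈ D, p ≠ q → ∃ A ∈ K, χ p A ≠ χ q A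
  span : ⨆ p ∈ D, U p = ⊤
  line : ∀ p ∈ D, Module.finrank ℂ (U p) = 1

namespace IsEigenlineDecomposition

variable {ι V : Type*} [AddCommGroup V] [Module ℂ V] {K : Set (Module.End ℂ V)} {D : Finset ι}
  {U : ι → Submodule ℂ V} {χ : ι → Module.End ℂ V → ℂ}

theorem exists_sum_eq (h : IsEigenlineDecomposition K D U χ) {W : Submodule ℂ V}
    (hW : ∀ A ∈ K, ∀ w ∈ W, A w ∈ W) {w : V} (hw : w ∈ W) :
    ∃ u : ι → V, (∀ p ∈ D, u p ∈ U p ∧ u p ∈ W) ∧ ∑ p ∈ D, u p = w := by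
  have hspan : w ∈ ⨆ p ∈ D, U p := h.span ▸ Submodule.mem_top
  obtain ⟨u, hu⟩ := (Submodule.mem_iSup_finset_iff_exists_sum _ _).1 hspan
  refine ⟨fun p => u p, fun p hp => ⟨(u p).2, ?_⟩, hu⟩
  exact mem_of_sum_mem_of_separated hW D h.sep (fun p => (u p : V))
    (fun p hp A hA => h.eig p hp A hA _ (u p).2) (hu ▸ hw) p hp

theorem eq_zero_of_sum_eq_zero (h : IsEigenlineDecomposition K D U χ) {u : ι → V}
    (hu : ∀ p ∈ D, u p ∈ U p) (hsum : ∑ p ∈ D, u p = 0) : ∀ p ∈ D, u p = 0 := by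
  have := mem_of_sum_mem_of_separated (W := (⊥ : Submodule ℂ V)) (K := K)
    (by simp) D h.sep u (fun p hp A hA => h.eig p hp A hA _ (hu p hp)) (by simpa using hsum)
  simpa using this

theorem component_eq_zero (h : IsEigenlineDecomposition K D U χ) {A : Module.End ℂ V}
    {τ : ι → ℂ} (hA : ∀ p ∈ D, ∀ v ∈ U p, A v = τ p • v) {a : ℂ} {u : ι → V}
    (hu : ∀ p ∈ D, u p ∈ U p) (heig : A (∑ p ∈ D, u p) = a • ∑ p ∈ D, u p) :
    ∀ p ∈ D, τ p ≠ a → u p = 0 := by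
  have hsum : ∑ p ∈ D, (τ p - a) • u p = 0 := by
    rw [map_sum, Finset.smul_sum, ← sub_eq_zero, ← Finset.sum_sub_distrib] at heig
    rw [← heig]
    refine Finset.sum_congr rfl fun p hp => ?_
    rw [hA p hp _ (hu p hp), sub_smul]
  intro p hp hne
  have := h.eq_zero_of_sum_eq_zero (fun p hp => (U p).smul_mem (τ p - a) (hu p hp)) hsum p hp
  exact (smul_eq_zero.1 this).resolve_left (sub_ne_zero.2 hne)

theorem le_of_mem (h : IsEigenlineDecomposition K D U χ) {W : Submodule ℂ V} {p : ι}
    (hp : p ∈ D) {u : V} (hu : u ∈ U p) (huW : u ∈ W) (hu0 : u ≠ 0) : U p ≤ W := by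
  intro v hv
  obtain ⟨c, hc⟩ := (finrank_eq_one_iff_of_nonzero' (⟨u, hu⟩ : U p)
    (by simpa using hu0)).1 (h.line p hp) ⟨v, hv⟩
  have : c • u = v := congrArg Subtype.val hc
  exact this ▸ W.smul_mem c huW

/-- A subspace contains the `a`-eigenspace of `A` once it contains the eigenlines on which `A`
acts as `a`. -/
theorem mem_of_eigenvector (h : IsEigenlineDecomposition K D U χ) {A : Module.End ℂ V}
    {τ : ι → ℂ} (hA : ∀ p ∈ D, ∀ v ∈ U p, A v = τ p • v) {a : ℂ} {W : Submodule ℂ V}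
    (hW : ∀ p ∈ D, τ p = a → U p ≤ W) {v : V} (hv : A v = a • v) : v ∈ W := by
  obtain ⟨u, hu, rfl⟩ := h.exists_sum_eq (W := ⊤) (by simp) (w := v) (by simp)
  refine W.sum_mem fun p hp => ?_
  by_cases hpa : τ p = a
  · exact hW p hp hpa (hu p hp).1
  · rw [h.component_eq_zero hA (fun p hp => (hu p hp).1) hv p hp hpa]
    exact W.zero_mem

theorem exists_le (h : IsEigenlineDecomposition K D U χ) {W : Submodule ℂ V}
    (hW : ∀ A ∈ K, ∀ w ∈ W, A w ∈ W) (hne : W ≠ ⊥) : ∃ p ∈ D, U p ≤ W := by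
  obtain ⟨w, hw, hw0⟩ := W.exists_mem_ne_zero_of_ne_bot hne
  obtain ⟨u, hu, rfl⟩ := h.exists_sum_eq hW hw
  obtain ⟨p, hp, hup⟩ := Finset.exists_ne_zero_of_sum_ne_zero hw0
  exact ⟨p, hp, h.le_of_mem hp (hu p hp).1 (hu p hp).2 hup⟩

theorem exists_le_of_eigenvector (h : IsEigenlineDecomposition K D U χ) {A : Module.End ℂ V}
    {τ : ι → ℂ} (hA : ∀ p ∈ D, ∀ v ∈ U p, A v = τ p • v) {a : ℂ} {W : Submodule ℂ V}
    (hW : ∀ A ∈ K, ∀ w ∈ W, A w ∈ W) {w : V} (hw : w ∈ W) (hw0 : w ≠ 0) (heig : A w = a • w) :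
    ∃ p ∈ D, τ p = a ∧ U p ≤ W := by
  obtain ⟨u, hu, rfl⟩ := h.exists_sum_eq hW hw
  obtain ⟨p, hp, hup⟩ := Finset.exists_ne_zero_of_sum_ne_zero hw0
  refine ⟨p, hp, ?_, h.le_of_mem hp (hu p hp).1 (hu p hp).2 hup⟩
  by_contra hpa
  exact hup (h.component_eq_zero hA (fun p hp => (hu p hp).1) heig p hp hpa)

theorem le_of_pairing_ne_zero (h : IsEigenlineDecomposition K D U χ) {B : V →ₗ[ℂ] V →ₗ[ℂ] ℂ}
    (hB : ∀ p ∈ D, ∀ q ∈ D, p ≠ q → ∀ v ∈ U p, ∀ w ∈ U q, B v w = 0)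
    {W : Submodule ℂ V} (hW : ∀ A ∈ K, ∀ w ∈ W, A w ∈ W) {T : Module.End ℂ V}
    (hT : ∀ w ∈ W, T w ∈ W) {p q : ι} (hq : q ∈ D) (hpW : U p ≤ W)
    (hpair : ∃ v ∈ U q, ∃ w ∈ U p, B v (T w) ≠ 0) : U q ≤ W := by
  obtain ⟨v, hv, w, hw, hne⟩ := hpair
  obtain ⟨u, hu, hsum⟩ := h.exists_sum_eq hW (hT w (hpW hw))
  have hBq : B v (T w) = B v (u q) := by
    rw [← hsum, map_sum]
    exact Finset.sum_eq_single_of_mem q hq fun r hr hrq => hB q hq r hr hrq.symm v hv _ (hu r hr).1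
  refine h.le_of_mem hq (hu q hq).1 (hu q hq).2 fun h0 => hne ?_
  rw [hBq, h0, map_zero]

theorem linearIndependent (h : IsEigenlineDecomposition K D U χ) {κ : Type*} {g : κ → ι}
    (hg : Function.Injective g) (hgD : ∀ k, g k ∈ D) {b : κ → V} (hb : ∀ k, b k ∈ U (g k))
    (hb0 : ∀ k, b k ≠ 0) : LinearIndependent ℂ b := by
  rw [linearIndependent_iff']
  intro s c hc k hk
  have := mem_of_sum_mem_of_separated (W := (⊥ : Submodule ℂ V)) (K := K) (χ := χ ∘ g)
    (by simp) s (fun i _ j _ hij => h.sep _ (hgD i) _ (hgD j) (hg.ne hij)) (fun i => c i • b i)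
    (fun i _ A hA => h.eig _ (hgD i) A hA _ ((U (g i)).smul_mem _ (hb i))) (by simpa using hc) k hk
  simpa [hb0 k] using this

theorem exists_mem_ne_zero (h : IsEigenlineDecomposition K D U χ) {p : ι} (hp : p ∈ D) :
    ∃ v ∈ U p, v ≠ 0 := by
  refine (U p).exists_mem_ne_zero_of_ne_bot fun h0 => ?_
  have := h.line p hp
  rw [h0, finrank_bot] at this
  exact zero_ne_one this

end IsEigenlineDecomposition

/-- If `f` is diagonalizable with spectrum in `T` and the eigenspaces of `f` restricted to an
invariant subspace `E` of dimension at least `#T` are at most one-dimensional, then every element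
of `T` is an eigenvalue of the restriction. -/
theorem exists_eigenvector_mem_of_card_le_finrank {V : Type*} [AddCommGroup V] [Module ℂ V]
    [FiniteDimensional ℂ V] {f : Module.End ℂ V} {T : Finset ℂ}
    (hT : ⨆ c ∈ T, f.eigenspace c = ⊤) {E : Submodule ℂ V} (hE : ∀ v ∈ E, f v ∈ E)
    (hdim : ∀ c ∈ T, Module.finrank ℂ ↥(E ⊓ f.eigenspace c) ≤ 1)
    (hcard : T.card ≤ Module.finrank ℂ E) {c : ℂ} (hc : c ∈ T) :
    ∃ v ∈ E, v ≠ 0 ∧ f v = c • v := by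
  classical
  by_contra! hno
  have hgen : ∀ d : ℂ, ∃ g : V, d ∈ T → ∀ v ∈ E, f v = d • v → v ∈ Submodule.span ℂ {g} := by
    intro d
    by_cases hd : d ∈ T
    · obtain ⟨g, hg⟩ := finrank_le_one_iff.1 (hdim d hd)
      refine ⟨g, fun _ v hv hfv => ?_⟩
      obtain ⟨a, ha⟩ := hg ⟨v, hv, Module.End.mem_eigenspace_iff.2 hfv⟩
      exact Submodule.mem_span_singleton.2 ⟨a, congrArg Subtype.val ha⟩
    · exact ⟨0, fun h => absurd h hd⟩
  choose g hg using hgen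
  have hle : E ≤ Submodule.span ℂ (((T.erase c).image g : Finset V) : Set V) := by
    intro v hv
    have hspan : v ∈ ⨆ c ∈ T, f.eigenspace c := hT ▸ Submodule.mem_top
    obtain ⟨u, hu⟩ := (Submodule.mem_iSup_finset_iff_exists_sum _ _).1 hspan
    have hfu : ∀ d, f (u d) = d • (u d : V) := fun d => Module.End.mem_eigenspace_iff.1 (u d).2
    have huE := mem_of_sum_mem_of_separated (K := {f}) (χ := fun d _ => d) (W := E)
      (by simpa using hE) T (fun i _ j _ hij => ⟨f, rfl, hij⟩) (fun d => (u d : V))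
      (fun d _ A hA => by rw [Set.mem_singleton_iff.1 hA, hfu d]) (hu ▸ hv)
    rw [← hu]
    refine Submodule.sum_mem _ fun d hd => ?_
    by_cases hdc : d = c
    · have h0 : (u d : V) = 0 := by
        by_contra h0
        exact hno _ (huE d hd) h0 (hdc ▸ hfu d)
      rw [h0]
      exact Submodule.zero_mem _
    · refine Submodule.span_mono ?_ (hg d hd _ (huE d hd) (hfu d))
      exact Set.singleton_subset_iff.2 (Finset.mem_coe.2
        (Finset.mem_image_of_mem g (Finset.mem_erase.2 ⟨hdc, hd⟩)))
  have h1 := Submodule.finrank_mono hle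
  have h2 := finrank_span_finset_le_card (R := ℂ) ((T.erase c).image g)
  have h3 : ((T.erase c).image g).card ≤ (T.erase c).card := Finset.card_image_le
  have h4 := Finset.card_erase_lt_of_mem hc
  unfold Set.finrank at h2
  omega

theorem isCommonEigenspace_eigenspace_inf {V : Type*} [AddCommGroup V] [Module ℂ V]
    {H : Submodule ℂ (Module.End ℂ V)} {X Y : Module.End ℂ V}
    (hH : X ∈ H ∧ Y ∈ H ∧ H = Submodule.span ℂ {X, Y}) {μ ν : ℂ}
    (hne : X.eigenspace μ ⊓ Y.eigenspace ν ≠ ⊥) :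
    IsCommonEigenspace H (X.eigenspace μ ⊓ Y.eigenspace ν) := by
  obtain ⟨hX, hY, hspan⟩ := hH
  refine ⟨hne, ?_⟩
  obtain ⟨v, ⟨hvX, hvY⟩, hv0⟩ := Submodule.exists_mem_ne_zero_of_ne_bot hne
  rw [SetLike.mem_coe, Module.End.mem_eigenspace_iff] at hvX hvY
  obtain ⟨φ, hφ⟩ := Module.Projective.exists_dual_ne_zero ℂ hv0
  have hscalar : ∀ A ∈ H, ∃ c : ℂ, ∀ w ∈ X.eigenspace μ ⊓ Y.eigenspace ν, A w = c • w := by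
    intro A hA
    rw [hspan, Submodule.mem_span_pair] at hA
    obtain ⟨a, b, rfl⟩ := hA
    refine ⟨a * μ + b * ν, fun w hw => ?_⟩
    obtain ⟨hwX, hwY⟩ := hw
    rw [SetLike.mem_coe, Module.End.mem_eigenspace_iff] at hwX hwY
    simp [hwX, hwY, add_smul, mul_smul]
  let χ : H →ₗ[ℂ] ℂ := (φ v)⁻¹ • (φ ∘ₗ LinearMap.applyₗ v ∘ₗ H.subtype)
  have hχ : ∀ (A : H) (c : ℂ), (A : Module.End ℂ V) v = c • v → χ A = c := by
    intro A c hA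
    simp only [χ, LinearMap.smul_apply, LinearMap.comp_apply, Submodule.subtype_apply,
      LinearMap.applyₗ_apply_apply, hA, map_smul, smul_eq_mul]
    field_simp
  refine ⟨χ, le_antisymm ?_ ?_⟩
  · refine le_iInf fun A w hw => ?_
    obtain ⟨c, hc⟩ := hscalar A A.2
    have hcχ := hχ A c (hc v ⟨Module.End.mem_eigenspace_iff.2 hvX,
      Module.End.mem_eigenspace_iff.2 hvY⟩)
    simp [hcχ, hc w hw]
  · intro w hw
    rw [Submodule.mem_iInf] at hw
    have hwX := hw ⟨X, hX⟩
    have hwY := hw ⟨Y, hY⟩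
    rw [hχ _ μ hvX] at hwX
    rw [hχ _ ν hvY] at hwY
    constructor
    · exact Module.End.mem_eigenspace_iff.2 (by simpa [sub_eq_zero] using hwX)
    · exact Module.End.mem_eigenspace_iff.2 (by simpa [sub_eq_zero] using hwY)

theorem iSup_eigenspace_inf_eigenspace_eq_top {V : Type*} [AddCommGroup V] [Module ℂ V]
    [FiniteDimensional ℂ V] {X Y : Module.End ℂ V} (hX : ⨆ μ : ℂ, X.eigenspace μ = ⊤)
    (hY : ⨆ ν : ℂ, Y.eigenspace ν = ⊤) (hXY : X * Y = Y * X) :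
    ⨆ μ : ℂ, ⨆ ν : ℂ, X.eigenspace μ ⊓ Y.eigenspace ν = ⊤ := by
  rw [← hX]
  refine iSup_congr fun μ => ?_
  have hinv : ∀ v ∈ X.eigenspace μ, Y v ∈ X.eigenspace μ := by
    intro v hv
    rw [Module.End.mem_eigenspace_iff] at hv ⊢
    rw [← Module.End.mul_apply, hXY, Module.End.mul_apply, hv, map_smul]
  have h := Submodule.inf_iSup_genEigenspace hinv 1
  exact h.symm.trans (by rw [show (⨆ ν, Y.genEigenspace ν 1) = ⊤ from hY, inf_top_eq])

/-- The common eigenspaces of a two-generated commuting space of diagonalizable operators form an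
eigenline decomposition as soon as they are one-dimensional. -/
theorem exists_isEigenlineDecomposition {ι V : Type*} [AddCommGroup V] [Module ℂ V]
    [FiniteDimensional ℂ V] {H : Submodule ℂ (Module.End ℂ V)} {X Y : Module.End ℂ V}
    (hH : X ∈ H ∧ Y ∈ H ∧ H = Submodule.span ℂ {X, Y})
    (hdiag : ∀ A ∈ H, (⨆ μ : ℂ, Module.End.eigenspace A μ) = ⊤)
    (hcomm : ∀ A ∈ H, ∀ A' ∈ H, A * A' = A' * A) {D : Finset ι} {U : ι → Submodule ℂ V}
    (heig : ∀ p ∈ D, IsCommonEigenspace H (U p))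
    (hinj : ∀ p ∈ D, ∀ q ∈ D, U p = U q → p = q)
    (hsurj : ∀ E : Submodule ℂ V, IsCommonEigenspace H E → ∃ p ∈ D, U p = E)
    (hline : ∀ p ∈ D, Module.finrank ℂ (U p) = 1) :
    ∃ χ, IsEigenlineDecomposition (H : Set (Module.End ℂ V)) D U χ := by
  classical
  have hχ : ∀ p, ∃ χ : H →ₗ[ℂ] ℂ, p ∈ D →
      U p = ⨅ A : H, LinearMap.ker ((A : Module.End ℂ V) - χ A • (1 : Module.End ℂ V)) := by
    intro p
    by_cases hp : p ∈ D
    · exact (heig p hp).2.imp fun χ h _ => h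
    · exact ⟨0, fun h => absurd h hp⟩
  choose χ hχ using hχ
  refine ⟨fun p A => if hA : A ∈ H then χ p ⟨A, hA⟩ else 0, ?_, ?_, ?_, hline⟩
  · intro p hp A hA v hv
    have hA' : A ∈ H := hA
    rw [hχ p hp, Submodule.mem_iInf] at hv
    simpa [hA', sub_eq_zero] using hv ⟨A, hA'⟩
  · intro p hp q hq hpq
    by_contra! hall
    refine hpq (hinj p hp q hq ?_)
    have hχeq : χ p = χ q := by
      ext A
      simpa using hall A A.2
    rw [hχ p hp, hχ q hq, hχeq]
  · rw [eq_top_iff, ← iSup_eigenspace_inf_eigenspace_eq_top (hdiag X hH.1) (hdiag Y hH.2.1)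
      (hcomm X hH.1 Y hH.2.1)]
    refine iSup_le fun μ => iSup_le fun ν => ?_
    by_cases hne : X.eigenspace μ ⊓ Y.eigenspace ν = ⊥
    · rw [hne]
      exact bot_le
    · obtain ⟨p, hp, hpe⟩ := hsurj _ (isCommonEigenspace_eigenspace_inf hH hne)
      exact hpe ▸ le_iSup₂_of_le p hp le_rfl

theorem of_forall_iff_succ {P : ℕ → Prop} {n : ℕ} (h : ∀ k < n, P k ↔ P (k + 1)) {a b : ℕ}
    (ha : a ≤ n) (hb : b ≤ n) (hPa : P a) : P b := by
  have h0 : ∀ k ≤ n, (P k ↔ P 0) := by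
    intro k
    induction k with
    | zero => simp
    | succ k ih => exact fun hk => (h k hk).symm.trans (ih (by omega))
  exact (h0 b hb).2 ((h0 a ha).1 hPa)

/-- Lemma: for a factorized `A₂`-Leonard pair, the irreducibility condition (v) is
redundant: it follows from the remaining conditions (i)-(iv), (vi)-(xi). -/
theorem irreducibility_redundant {N : ℕ} (hN : 0 < N) {V : Type*} [AddCommGroup V]
    [Module ℂ V] [FiniteDimensional ℂ V] (F : FactorizedA2LeonardPairWithoutIrred N V) :
    ∀ W : Submodule ℂ V, (∀ A ∈ F.H, Submodule.map A W ≤ W) →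
      (∀ A ∈ F.Hs, Submodule.map A W ≤ W) → W = ⊥ ∨ W = ⊤ := by
  classical
  intro W hWH hWHs
  obtain ⟨D, hD⟩ : ∃ D : Finset (ℕ × ℕ), ∀ p, p ∈ D ↔ p ∈ domD N :=
    ⟨(Finset.range (N + 1) ×ˢ Finset.range (N + 1)).filter fun p => p.1 + p.2 ≤ N, fun p => by
      simp only [Finset.mem_filter, Finset.mem_product, Finset.mem_range, domD, Set.mem_ofPred_eq]
      omega⟩
  have hDle : ∀ x y, (x, y) ∈ D ↔ x + y ≤ N := fun x y => hD (x, y)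
  have hXH := F.basisH.1
  have hYsHs := F.basisHs.2.1
  have hW : ∀ A ∈ F.H, ∀ w ∈ W, A w ∈ W := fun A hA w hw => hWH A hA ⟨w, hw, rfl⟩
  have hWs : ∀ A ∈ F.Hs, ∀ w ∈ W, A w ∈ W := fun A hA w hw => hWHs A hA ⟨w, hw, rfl⟩
  obtain ⟨χ, dec⟩ := exists_isEigenlineDecomposition (D := D) F.basisH F.diagH F.commH
    (by simpa only [hD] using F.eigV) (by simpa only [hD] using F.injV)
    (by simpa only [hD] using F.surjV) (by simpa only [hD] using F.dimV)
  obtain ⟨χs, decs⟩ := exists_isEigenlineDecomposition (D := D) F.basisHs F.diagHs F.commHs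
    (by simpa only [hD] using F.eigVs) (by simpa only [hD] using F.injVs)
    (by simpa only [hD] using F.surjVs) (by simpa only [hD] using F.dimVs)
  have eigX : ∀ p ∈ D, ∀ v ∈ F.Vsub p, F.X v = F.t p.1 • v := by simpa only [hD] using F.eigX
  have eigYs : ∀ p ∈ D, ∀ v ∈ F.Vssub p, F.Ys v = F.θs p.2 • v := by
    simpa only [hD] using F.eigYs
  have column : ∀ x y y', x + y ≤ N → x + y' ≤ N → F.Vsub (x, y) ≤ W → F.Vsub (x, y') ≤ W := by
    intro x y y' hy hy' h
    refine of_forall_iff_succ (P := fun y => F.Vsub (x, y) ≤ W) (n := N - x) ?_ (by omega)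
      (by omega) h
    intro k hk
    have hk0 := (hDle x k).2 (by omega)
    have hk1 := (hDle x (k + 1)).2 (by omega)
    obtain ⟨hup, hdown⟩ := F.irr2 x k ((hD _).1 hk0) ((hD _).1 hk1)
    have hB : ∀ p ∈ D, ∀ q ∈ D, p ≠ q → ∀ v ∈ F.Vsub p, ∀ w ∈ F.Vsub q, F.B v w = 0 := by
      simpa only [hD] using F.orthoV
    exact ⟨fun h => dec.le_of_pairing_ne_zero hB hW (hWs _ hYsHs) hk1 h hup,
      fun h => dec.le_of_pairing_ne_zero hB hW (hWs _ hYsHs) hk0 h hdown⟩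
  have row : ∀ i i', i ≤ N → i' ≤ N → F.Vssub (i, 0) ≤ W → F.Vssub (i', 0) ≤ W := by
    intro i i' hi hi' h
    refine of_forall_iff_succ (P := fun i => F.Vssub (i, 0) ≤ W) (n := N) ?_ hi hi' h
    intro k hk
    have hk0 := (hDle k 0).2 (by omega)
    have hk1 := (hDle (k + 1) 0).2 (by omega)
    obtain ⟨hup, hdown⟩ := F.irr1 k 0 ((hD _).1 hk0) ((hD _).1 hk1)
    have hB : ∀ p ∈ D, ∀ q ∈ D, p ≠ q → ∀ v ∈ F.Vssub p, ∀ w ∈ F.Vssub q, F.B v w = 0 := by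
      simpa only [hD] using F.orthoVs
    exact ⟨fun h => decs.le_of_pairing_ne_zero hB hWs (hW _ hXH) hk1 h hup,
      fun h => decs.le_of_pairing_ne_zero hB hWs (hW _ hXH) hk0 h hdown⟩
  have fst_eq : ∀ p ∈ D, ∀ x ≤ N, F.t p.1 = F.t x → p.1 = x := by
    intro p hp x hx h
    have := (hDle p.1 p.2).1 hp
    by_contra hne
    exact F.t_distinct p.1 (by omega) x hx hne h
  have snd_eq : ∀ p ∈ D, F.θs p.2 = F.θs 0 → p.2 = 0 := by
    intro p hp h
    have := (hDle p.1 p.2).1 hp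
    by_contra hne
    exact F.θs_distinct p.2 (by omega) 0 (by omega) hne h
  -- `X` has all the eigenvalues `t_0, …, t_N` on the eigenspace of `Y*` for `θ*_0`
  have common : ∀ x ≤ N, ∃ v, v ≠ 0 ∧ F.X v = F.t x • v ∧ F.Ys v = F.θs 0 • v := by
    intro x hx
    obtain ⟨v, hv, hv0, hXv⟩ := exists_eigenvector_mem_of_card_le_finrank (f := F.X)
      (T := (Finset.range (N + 1)).image F.t) (E := F.Ys.eigenspace (F.θs 0)) (c := F.t x)
      (by
        rw [eq_top_iff, ← dec.span]
        refine iSup₂_le fun p hp => ?_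
        have := (hDle p.1 p.2).1 hp
        refine le_iSup₂_of_le (F.t p.1)
          (Finset.mem_image_of_mem _ (Finset.mem_range.2 (by omega))) fun v hv => ?_
        exact Module.End.mem_eigenspace_iff.2 (eigX p hp v hv))
      (by
        intro v hv
        rw [Module.End.mem_eigenspace_iff] at hv ⊢
        rw [← Module.End.mul_apply, ← F.commXYs, Module.End.mul_apply, hv, map_smul])
      (by
        intro c _
        rw [inf_comm]
        by_cases hbot : F.X.eigenspace c ⊓ F.Ys.eigenspace (F.θs 0) = ⊥
        · rw [hbot, finrank_bot]
          exact zero_le_one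
        · rw [Module.End.eigenspace_def, Module.End.eigenspace_def] at hbot ⊢
          exact (F.commonDim c (F.θs 0) hbot).le)
      (by
        have hmem : ∀ k : Fin (N + 1), ((k : ℕ), 0) ∈ D := fun k => (hDle _ _).2 (by omega)
        choose b hb hb0 using fun k => decs.exists_mem_ne_zero (hmem k)
        have hli := decs.linearIndependent (g := fun k : Fin (N + 1) => ((k : ℕ), 0))
          (fun i j hij => Fin.ext (congrArg Prod.fst hij)) hmem hb hb0
        have hle : Submodule.span ℂ (Set.range b) ≤ F.Ys.eigenspace (F.θs 0) := by
          rw [Submodule.span_le]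
          rintro _ ⟨k, rfl⟩
          exact Module.End.mem_eigenspace_iff.2 (eigYs _ (hmem k) _ (hb k))
        have h1 := Submodule.finrank_mono hle
        rw [finrank_span_eq_card hli, Fintype.card_fin] at h1
        exact (Finset.card_image_le.trans (Finset.card_range _).le).trans h1)
      (Finset.mem_image_of_mem _ (Finset.mem_range.2 (by omega)))
    exact ⟨v, hv0, hXv, Module.End.mem_eigenspace_iff.1 hv⟩
  refine or_iff_not_imp_left.2 fun hne => ?_
  obtain ⟨⟨x, y⟩, hp, hpW⟩ := dec.exists_le hW hne
  have hxy := (hDle x y).1 hp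
  obtain ⟨v, hv0, hXv, hYsv⟩ := common x (by omega)
  have hvW : v ∈ W := by
    refine dec.mem_of_eigenvector eigX (a := F.t x) ?_ hXv
    rintro ⟨x', y'⟩ hq hx'
    obtain rfl : x' = x := fst_eq _ hq x (by omega) hx'
    exact column x' y y' hxy ((hDle _ _).1 hq) hpW
  obtain ⟨⟨i, j⟩, hq, hj, hqW⟩ := decs.exists_le_of_eigenvector eigYs hWs hvW hv0 hYsv
  obtain rfl : j = 0 := snd_eq _ hq hj
  rw [eq_top_iff, ← dec.span]
  refine iSup₂_le ?_
  rintro ⟨x', y'⟩ hp'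
  have hxy' := (hDle x' y').1 hp'
  obtain ⟨v', hv0', hXv', hYsv'⟩ := common x' (by omega)
  have hvW' : v' ∈ W := by
    refine decs.mem_of_eigenvector eigYs (a := F.θs 0) ?_ hYsv'
    rintro ⟨i', j'⟩ hq' hj'
    obtain rfl : j' = 0 := snd_eq _ hq' hj'
    exact row i i' ((hDle _ _).1 hq) ((hDle _ _).1 hq') hqW
  obtain ⟨⟨x'', y''⟩, hr, hx'', hrW⟩ := dec.exists_le_of_eigenvector eigX hW hvW' hv0' hXv'
  obtain rfl : x'' = x' := fst_eq _ hr x' (by omega) hx''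
  exact column x'' y'' y' ((hDle _ _).1 hr) hxy' hrW
end

section
/- Fix an integer d ≥ 1 and complex parameters ρ, σ* such that σ* + m ≠ 0 for all integers 1 ≤ m ≤ 2d + 2, ρ + m ≠ 0 for all integers 1 ≤ m ≤ d, and σ* − ρ + m ≠ 0 for all integers 1 ≤ m ≤ d + 1. Then for all integers 0 ≤ x ≤ d − 1 and 0 ≤ i ≤ d − 1, the following contiguity relation for the normalized Hahn functions holds: ((σ* + 1 − ρ)/(2 + σ*)) · p_{x,i}(d; ρ, σ*) = ((i + ρ)/(2i + σ*)) · p_{x,i−1}(d−1; ρ, σ*+1) + ((i + 1 + σ* − ρ)/(2i + σ* + 2)) · p_{x,i}(d−1; ρ, σ*+1). -/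
/-- Pochhammer symbol `(a)_k = a (a+1) ⋯ (a+k-1)`. -/
noncomputable def poch (a : ℂ) (k : ℕ) : ℂ := ∏ l ∈ Finset.range k, (a + l)

/-- Normalized Hahn function `p_{x,i}(d; ρ, σ*)`, with the convention that it
vanishes for negative `i`. -/
noncomputable def hahnP (d : ℕ) (ρ σs : ℂ) (x : ℕ) (i : ℤ) : ℂ :=
  if i < 0 then 0
  else
    (d.choose i.toNat : ℂ) * poch (ρ + 1) i.toNat * poch (2 + σs) d /
        (poch (σs - ρ + 1) i.toNat * poch (σs + 1 + (i.toNat : ℂ)) i.toNat *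
          poch (σs + 2 * (i.toNat : ℂ) + 2) (d - i.toNat)) *
      ∑ k ∈ Finset.range (min i.toNat x + 1),
        poch (-(i.toNat : ℂ)) k * poch ((i.toNat : ℂ) + 1 + σs) k * poch (-(x : ℂ)) k /
          (poch (ρ + 1) k * poch (-(d : ℂ)) k * (k.factorial : ℂ))

theorem poch_succ (a : ℂ) (k : ℕ) : poch a (k + 1) = poch a k * (a + k) := by
  simp [poch, Finset.prod_range_succ]

theorem poch_succ_left (a : ℂ) (k : ℕ) : poch a (k + 1) = a * poch (a + 1) k := by
  simp only [poch, Finset.prod_range_succ']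
  push_cast
  rw [mul_comm]
  congr 1
  · simp
  · exact Finset.prod_congr rfl fun l _ => by ring

/-- Shifting the argument of the Pochhammer symbol by one. -/
theorem mul_poch_add_one (a : ℂ) (k : ℕ) : a * poch (a + 1) k = poch a k * (a + k) := by
  rw [← poch_succ_left, poch_succ]

theorem poch_ne_zero {a : ℂ} {k : ℕ} (h : ∀ l < k, a + (l : ℂ) ≠ 0) : poch a k ≠ 0 :=
  Finset.prod_ne_zero_iff.mpr fun l hl => h l (Finset.mem_range.mp hl)

theorem poch_neg_natCast_eq_zero {i k : ℕ} (h : i < k) : poch (-(i : ℂ)) k = 0 :=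
  Finset.prod_eq_zero (Finset.mem_range.mpr h) (by ring)

/-- The normalizing factor of the Hahn functions. -/
noncomputable def hahnFactor (d : ℕ) (ρ σs : ℂ) (i : ℕ) : ℂ :=
  (d.choose i : ℂ) * poch (ρ + 1) i * poch (2 + σs) d /
    (poch (σs - ρ + 1) i * poch (σs + 1 + (i : ℂ)) i * poch (σs + 2 * (i : ℂ) + 2) (d - i))

/-- The `k`-th term of the hypergeometric sum defining the Hahn functions. -/
noncomputable def hahnTerm (d ρ σs x i : ℂ) (k : ℕ) : ℂ :=
  poch (-i) k * poch (i + 1 + σs) k * poch (-x) k /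
    (poch (ρ + 1) k * poch (-d) k * (k.factorial : ℂ))

theorem hahnP_natCast (d : ℕ) (ρ σs : ℂ) (x i : ℕ) :
    hahnP d ρ σs x (i : ℤ) =
      hahnFactor d ρ σs i * ∑ k ∈ Finset.range (x + 1), hahnTerm d ρ σs x i k := by
  have h : ¬ ((i : ℤ) < 0) := by omega
  simp only [hahnP, if_neg h, Int.toNat_natCast]
  rw [hahnFactor]
  congr 1
  apply Finset.sum_subset
  · intro k hk
    simp only [Finset.mem_range] at hk ⊢
    omega
  · intro k hk hk'
    simp only [Finset.mem_range] at hk hk'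
    rw [poch_neg_natCast_eq_zero (show i < k by omega)]
    simp

theorem hahnTerm_contiguity {n k : ℕ} (hk : k ≤ n) (ρ σs x i : ℂ) :
    ((n : ℂ) + 1) * (σs + 2 * i + 1) * hahnTerm ((n : ℂ) + 1) ρ σs x i k =
      i * (σs + n + i + 2) * hahnTerm n ρ (σs + 1) x (i - 1) k +
        ((n : ℂ) + 1 - i) * (σs + 1 + i) * hahnTerm n ρ (σs + 1) x i k := by
  have hi := mul_poch_add_one (-i) k
  have hσ := mul_poch_add_one (i + 1 + σs) k
  have hd := mul_poch_add_one (-((n : ℂ) + 1)) k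
  have hn : ((n : ℂ) + 1) ≠ 0 := by exact_mod_cast Nat.succ_ne_zero n
  have hnk : ((n : ℂ) + 1 - k) ≠ 0 := by
    rw [sub_ne_zero]; exact_mod_cast (by omega : n + 1 ≠ k)
  rw [show -((n : ℂ) + 1) + 1 = -n by ring] at hd
  have hd' : poch (-((n : ℂ) + 1)) k = (n + 1) * poch (-(n : ℂ)) k / (n + 1 - k) := by
    rw [eq_div_iff hnk]; linear_combination hd
  simp only [hahnTerm, hd']
  rw [show -(i - 1) = -i + 1 by ring, show i - 1 + 1 + (σs + 1) = i + 1 + σs by ring,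
    show i + 1 + (σs + 1) = i + 1 + σs + 1 by ring]
  generalize poch (-i + 1) k = a at *
  generalize poch (i + 1 + σs + 1) k = b at *
  rw [show poch (-i) k * poch (i + 1 + σs) k * poch (-x) k /
      (poch (ρ + 1) k * ((n + 1) * poch (-(n : ℂ)) k / (n + 1 - k)) * (k.factorial : ℂ)) =
      ((n + 1 - k) / (n + 1)) * (poch (-i) k * poch (i + 1 + σs) k * poch (-x) k /
      (poch (ρ + 1) k * poch (-(n : ℂ)) k * (k.factorial : ℂ))) by
    simp only [div_eq_mul_inv, mul_inv, inv_inv]; ring]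
  simp only [div_eq_mul_inv]
  generalize (poch (ρ + 1) k * poch (-(n : ℂ)) k * (k.factorial : ℂ))⁻¹ = r
  field_simp
  linear_combination (σs + n + i + 2) * poch (i + 1 + σs) k * poch (-x) k * r * hi
    - (n + 1 - i) * poch (-i) k * poch (-x) k * r * hσ

theorem hahnFactor_contiguity {n i : ℕ} (hi : i ≤ n) (ρ σs : ℂ)
    (hσ : ∀ m : ℕ, 1 ≤ m → m ≤ 2 * n + 4 → σs + (m : ℂ) ≠ 0)
    (hσρ : ∀ m : ℕ, 1 ≤ m → m ≤ n + 2 → σs - ρ + (m : ℂ) ≠ 0) :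
    ((i : ℂ) + 1 + σs - ρ) / (2 * (i : ℂ) + σs + 2) * hahnFactor n ρ (σs + 1) i *
        (((n : ℂ) + 1) * (σs + 2 * i + 1)) =
      (σs + 1 - ρ) / (2 + σs) * hahnFactor (n + 1) ρ σs i *
        (((n : ℂ) + 1 - i) * (σs + 1 + i)) := by
  have h2 : 2 + σs ≠ 0 := by simpa [add_comm] using hσ 2 (by omega) (by omega)
  have h1i : σs + 1 + i ≠ 0 := by
    have := hσ (i + 1) (by omega) (by omega); push_cast at this
    convert this using 1; ring
  have h2i1 : σs + 2 * i + 1 ≠ 0 := by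
    have := hσ (2 * i + 1) (by omega) (by omega); push_cast at this
    convert this using 1; ring
  have h2i2 : 2 * (i : ℂ) + σs + 2 ≠ 0 := by
    have := hσ (2 * i + 2) (by omega) (by omega); push_cast at this
    convert this using 1; ring
  have hr1 : σs - ρ + 1 ≠ 0 := by simpa using hσρ 1 le_rfl (by omega)
  have hri : σs - ρ + 1 + i ≠ 0 := by
    have := hσρ (i + 1) (by omega) (by omega); push_cast at this
    convert this using 1; ring
  have hA : poch (σs - ρ + 1) i ≠ 0 := poch_ne_zero fun l hl => by
    have := hσρ (l + 1) (by omega) (by omega); push_cast at this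
    convert this using 1; ring
  have hB : poch (σs + 1 + i) i ≠ 0 := poch_ne_zero fun l hl => by
    have := hσ (i + l + 1) (by omega) (by omega); push_cast at this
    convert this using 1; ring
  have hC : poch (σs + 2 * i + 3) (n - i) ≠ 0 := poch_ne_zero fun l hl => by
    have := hσ (2 * i + l + 3) (by omega) (by omega); push_cast at this
    convert this using 1; ring
  have eA := mul_poch_add_one (σs - ρ + 1) i
  have eB := mul_poch_add_one (σs + 1 + i) i
  have eC := poch_succ_left (σs + 2 * i + 2) (n - i)
  have eD := poch_succ_left (2 + σs) n
  have eA' : poch (σs + 1 - ρ + 1) i =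
      poch (σs - ρ + 1) i * (σs - ρ + 1 + i) / (σs - ρ + 1) := by
    rw [eq_div_iff hr1, ← eA, show σs + 1 - ρ + 1 = σs - ρ + 1 + 1 by ring]; ring
  have eB' : poch (σs + 1 + 1 + i) i =
      poch (σs + 1 + i) i * (σs + 2 * i + 1) / (σs + 1 + i) := by
    rw [eq_div_iff h1i, show σs + 2 * i + 1 = σs + 1 + i + (i : ℂ) by ring, ← eB,
      show σs + 1 + 1 + i = σs + 1 + (i : ℂ) + 1 by ring]; ring
  have hch : ((n.choose i : ℕ) : ℂ) * (n + 1) = ((n + 1).choose i : ℕ) * (n + 1 - i) := by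
    have := congrArg (Nat.cast (R := ℂ)) (Nat.choose_mul_succ_eq n i)
    push_cast [Nat.cast_sub (show i ≤ n + 1 by omega)] at this
    exact this
  rw [hahnFactor, hahnFactor, eA', eB', show n + 1 - i = n - i + 1 by omega, eC, eD,
    show 2 + (σs + 1) = 2 + σs + 1 by ring,
    show σs + 1 + 2 * (i : ℂ) + 2 = σs + 2 * i + 3 by ring,
    show σs + 2 * (i : ℂ) + 2 + 1 = σs + 2 * i + 3 by ring,
    show σs + 2 * (i : ℂ) + 2 = 2 * (i : ℂ) + σs + 2 by ring,
    show (i : ℂ) + 1 + σs - ρ = σs - ρ + 1 + i by ring,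
    show σs + 1 - ρ = σs - ρ + 1 by ring]
  generalize σs - ρ + 1 + (i : ℂ) = u at *
  generalize σs - ρ + 1 = v at *
  generalize 2 * (i : ℂ) + σs + 2 = w at *
  generalize 2 + σs = y at *
  generalize σs + 2 * (i : ℂ) + 1 = z at *
  generalize poch (σs + 2 * (i : ℂ) + 3) (n - i) = c at *
  field_simp
  linear_combination poch (ρ + 1) i * poch (y + 1) n * hch

theorem hahnFactor_contiguity_pred {n j : ℕ} (hj : j + 1 ≤ n) (ρ σs : ℂ)
    (hσ : ∀ m : ℕ, 1 ≤ m → m ≤ 2 * n + 4 → σs + (m : ℂ) ≠ 0)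
    (hσρ : ∀ m : ℕ, 1 ≤ m → m ≤ n + 2 → σs - ρ + (m : ℂ) ≠ 0) :
    ((j : ℂ) + 1 + ρ) / (2 * ((j : ℂ) + 1) + σs) * hahnFactor n ρ (σs + 1) j *
        (((n : ℂ) + 1) * (σs + 2 * ((j : ℂ) + 1) + 1)) =
      (σs + 1 - ρ) / (2 + σs) * hahnFactor (n + 1) ρ σs (j + 1) *
        (((j : ℂ) + 1) * (σs + n + ((j : ℂ) + 1) + 2)) := by
  have h2 : 2 + σs ≠ 0 := by simpa [add_comm] using hσ 2 (by omega) (by omega)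
  have h2j2 : 2 * ((j : ℂ) + 1) + σs ≠ 0 := by
    have := hσ (2 * j + 2) (by omega) (by omega); push_cast at this
    convert this using 1; ring
  have h2j3 : σs + 2 * (j : ℂ) + 3 ≠ 0 := by
    have := hσ (2 * j + 3) (by omega) (by omega); push_cast at this
    convert this using 1; ring
  have hnj : σs + n + ((j : ℂ) + 1) + 2 ≠ 0 := by
    have := hσ (n + j + 3) (by omega) (by omega); push_cast at this
    convert this using 1; ring
  have hr1 : σs - ρ + 1 ≠ 0 := by simpa using hσρ 1 le_rfl (by omega)
  have hA : poch (σs - ρ + 1 + 1) j ≠ 0 := poch_ne_zero fun l hl => by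
    have := hσρ (l + 2) (by omega) (by omega); push_cast at this
    convert this using 1; ring
  have hB : poch (σs + 2 + j) j ≠ 0 := poch_ne_zero fun l hl => by
    have := hσ (j + l + 2) (by omega) (by omega); push_cast at this
    convert this using 1; ring
  have hC : poch (σs + 2 * j + 3) (n - j) ≠ 0 := poch_ne_zero fun l hl => by
    have := hσ (2 * j + l + 3) (by omega) (by omega); push_cast at this
    convert this using 1; ring
  have eA := poch_succ_left (σs - ρ + 1) j
  have eB := poch_succ (σs + 2 + j) j
  have eC := mul_poch_add_one (σs + 2 * j + 3) (n - j)
  have eD := poch_succ_left (2 + σs) n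
  have eE := poch_succ (ρ + 1) j
  have eC' : poch (σs + 2 * j + 3 + 1) (n - j) =
      poch (σs + 2 * j + 3) (n - j) * (σs + n + ((j : ℂ) + 1) + 2) / (σs + 2 * j + 3) := by
    rw [eq_div_iff h2j3, mul_comm, eC, Nat.cast_sub (by omega : j ≤ n)]
    ring
  have hch : ((n : ℂ) + 1) * ((n.choose j : ℕ) : ℂ) =
      ((n + 1).choose (j + 1) : ℕ) * ((j : ℂ) + 1) := by
    exact_mod_cast Nat.add_one_mul_choose_eq n j
  rw [hahnFactor, hahnFactor, Nat.add_sub_add_right]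
  push_cast
  rw [show σs + 1 + ((j : ℂ) + 1) = σs + 2 + j by ring, eA, eB, eE,
    eD,
    show σs + 2 * ((j : ℂ) + 1) + 2 = σs + 2 * j + 3 + 1 by ring, eC',
    show σs + 1 - ρ + 1 = σs - ρ + 1 + 1 by ring,
    show 2 + (σs + 1) = 2 + σs + 1 by ring,
    show σs + 1 + 1 + (j : ℂ) = σs + 2 + j by ring,
    show σs + 1 + 2 * (j : ℂ) + 2 = σs + 2 * j + 3 by ring,
    show σs + 2 * ((j : ℂ) + 1) + 1 = σs + 2 * j + 3 by ring,
    show σs + 2 + (j : ℂ) + j = 2 * ((j : ℂ) + 1) + σs by ring,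
    show σs + 1 - ρ = σs - ρ + 1 by ring]
  generalize σs + n + ((j : ℂ) + 1) + 2 = u at *
  generalize σs + 2 * (j : ℂ) + 3 = v at *
  generalize 2 * ((j : ℂ) + 1) + σs = w at *
  generalize 2 + σs = y at *
  generalize poch (σs - ρ + 1 + 1) j = a at *
  generalize σs - ρ + 1 = z at *
  generalize poch v (n - j) = c at *
  field_simp
  linear_combination (ρ + 1 + j) * poch (ρ + 1) j * poch (y + 1) n * hch

theorem hahn_contiguity_lower (d : ℕ) (hd : 1 ≤ d) (ρ σs : ℂ)
    (hσ : ∀ m : ℕ, 1 ≤ m → m ≤ 2 * d + 2 → σs + (m : ℂ) ≠ 0)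
    (hρ : ∀ m : ℕ, 1 ≤ m → m ≤ d → ρ + (m : ℂ) ≠ 0)
    (hσρ : ∀ m : ℕ, 1 ≤ m → m ≤ d + 1 → σs - ρ + (m : ℂ) ≠ 0)
    (x i : ℕ) (hx : x ≤ d - 1) (hi : i ≤ d - 1) :
    (σs + 1 - ρ) / (2 + σs) * hahnP d ρ σs x (i : ℤ) =
      ((i : ℂ) + ρ) / (2 * (i : ℂ) + σs) * hahnP (d - 1) ρ (σs + 1) x ((i : ℤ) - 1) +
        ((i : ℂ) + 1 + σs - ρ) / (2 * (i : ℂ) + σs + 2) *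
          hahnP (d - 1) ρ (σs + 1) x (i : ℤ) := by
  obtain ⟨n, rfl⟩ : ∃ n, d = n + 1 := ⟨d - 1, by omega⟩
  simp only [Nat.add_sub_cancel] at hx hi ⊢
  have hσ' : ∀ m : ℕ, 1 ≤ m → m ≤ 2 * n + 4 → σs + (m : ℂ) ≠ 0 :=
    fun m h1 h2 => hσ m h1 (by omega)
  have hσρ' : ∀ m : ℕ, 1 ≤ m → m ≤ n + 2 → σs - ρ + (m : ℂ) ≠ 0 :=
    fun m h1 h2 => hσρ m h1 (by omega)
  have hK : ((n : ℂ) + 1) * (σs + 2 * i + 1) ≠ 0 := by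
    refine mul_ne_zero (by exact_mod_cast Nat.succ_ne_zero n) ?_
    have := hσ (2 * i + 1) (by omega) (by omega); push_cast at this
    convert this using 1; ring
  have hT : ((n : ℂ) + 1) * (σs + 2 * i + 1) *
        ∑ k ∈ Finset.range (x + 1), hahnTerm ((n : ℂ) + 1) ρ σs x i k =
      i * (σs + n + i + 2) * ∑ k ∈ Finset.range (x + 1), hahnTerm n ρ (σs + 1) x (i - 1) k +
        ((n : ℂ) + 1 - i) * (σs + 1 + i) *
          ∑ k ∈ Finset.range (x + 1), hahnTerm n ρ (σs + 1) x i k := by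
    simp only [Finset.mul_sum, ← Finset.sum_add_distrib]
    refine Finset.sum_congr rfl fun k hk => hahnTerm_contiguity ?_ ρ σs x i
    have := Finset.mem_range.mp hk
    omega
  have hF := hahnFactor_contiguity hi ρ σs hσ' hσρ'
  apply mul_left_cancel₀ hK
  rw [hahnP_natCast, hahnP_natCast]
  push_cast
  obtain _ | j := i
  · have h0 : hahnP n ρ (σs + 1) x (((0 : ℕ) : ℤ) - 1) = 0 := by simp [hahnP]
    rw [h0]
    push_cast at hT hF ⊢
    linear_combination (σs + 1 - ρ) / (2 + σs) * hahnFactor (n + 1) ρ σs 0 * hT -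
      (∑ k ∈ Finset.range (x + 1), hahnTerm n ρ (σs + 1) x 0 k) * hF
  · have hG := hahnFactor_contiguity_pred hi ρ σs hσ' hσρ'
    rw [show ((j + 1 : ℕ) : ℤ) - 1 = (j : ℤ) by push_cast; ring, hahnP_natCast]
    push_cast at hT hF ⊢
    rw [show (j : ℂ) + 1 - 1 = j by ring] at hT
    linear_combination (σs + 1 - ρ) / (2 + σs) * hahnFactor (n + 1) ρ σs (j + 1) * hT -
      (∑ k ∈ Finset.range (x + 1), hahnTerm n ρ (σs + 1) x (j + 1) k) * hF -
      (∑ k ∈ Finset.range (x + 1), hahnTerm n ρ (σs + 1) x j k) * hG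
end

section
/- Fix an integer d ≥ 1 and complex parameters σ, σ*, ρ with ρ ≠ 0 and σσ* ≠ ρ. Then for all integers 0 ≤ x ≤ d − 1 and 0 ≤ i ≤ d − 1, the following contiguity relation for the normalized Krawtchouk functions holds: p_{x,i}(d; σ, σ*, ρ) = p_{x,i}(d−1; σ, σ*, ρ) + (ρ/(σσ* − ρ)) · p_{x,i−1}(d−1; σ, σ*, ρ). -/
/-- Normalized Krawtchouk function `p_{x,i}(d; σ, σ*, ρ)`, with the convention that it
vanishes for negative `i`. -/
noncomputable def krawP (d : ℕ) (σ σs ρ : ℂ) (x : ℕ) (i : ℤ) : ℂ :=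
  if i < 0 then 0
  else
    (ρ / (σ * σs - ρ)) ^ i.toNat * (d.choose i.toNat : ℂ) *
      ∑ k ∈ Finset.range (min i.toNat x + 1),
        poch (-(i.toNat : ℂ)) k * poch (-(x : ℂ)) k /
          (poch (-(d : ℂ)) k * (k.factorial : ℂ)) * (σ * σs / ρ) ^ k

theorem poch_neg_natCast (n k : ℕ) :
    poch (-(n : ℂ)) k = (-1) ^ k * (n.descFactorial k : ℂ) := by
  unfold poch
  induction k with
  | zero => simp
  | succ k ih =>
    rw [Finset.prod_range_succ, ih, Nat.descFactorial_succ]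
    rcases le_or_gt k n with h | h
    · push_cast [Nat.cast_sub h]
      ring
    · simp [Nat.descFactorial_eq_zero_iff_lt.2 h]

theorem choose_mul_poch_div_poch {n k : ℕ} (i : ℕ) (hk : k ≤ n) :
    (n.choose i : ℂ) * (poch (-(i : ℂ)) k / poch (-(n : ℂ)) k) =
      if k ≤ i then ((n - k).choose (i - k) : ℂ) else 0 := by
  have hn : (n.descFactorial k : ℂ) ≠ 0 := by
    exact_mod_cast fun h => (Nat.descFactorial_eq_zero_iff_lt.1 h).not_ge hk
  rw [poch_neg_natCast, poch_neg_natCast, mul_div_mul_left _ _ (by simp)]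
  split_ifs with hki
  · have h := Nat.choose_mul (n := n) hki
    rw [← mul_div_assoc, div_eq_iff hn, Nat.descFactorial_eq_factorial_mul_choose,
      Nat.descFactorial_eq_factorial_mul_choose]
    have h' : (n.choose i : ℂ) * i.choose k = n.choose k * (n - k).choose (i - k) := by
      exact_mod_cast h
    push_cast
    linear_combination (k.factorial : ℂ) * h'
  · simp [Nat.descFactorial_eq_zero_iff_lt.2 (not_le.1 hki)]

theorem krawP_natCast {d x : ℕ} (σ σs ρ : ℂ) (i : ℕ) (hx : x ≤ d) :
    krawP d σ σs ρ x (i : ℤ) =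
      (ρ / (σ * σs - ρ)) ^ i * ∑ k ∈ Finset.range (x + 1),
        (if k ≤ i then ((d - k).choose (i - k) : ℂ) else 0) *
          (poch (-(x : ℂ)) k / (k.factorial : ℂ) * (σ * σs / ρ) ^ k) := by
  rw [krawP, if_neg (by omega), Int.toNat_natCast, mul_assoc, Finset.mul_sum]
  congr 1
  symm
  rw [← Finset.sum_subset (s₁ := Finset.range (min i x + 1))]
  · refine Finset.sum_congr rfl fun k hk => ?_
    rw [← choose_mul_poch_div_poch i (by rw [Finset.mem_range] at hk; omega)]
    ring
  · exact Finset.range_subset_range.2 (by omega)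
  · intro k hk hk'
    simp only [Finset.mem_range] at hk hk'
    rw [if_neg (by omega), zero_mul]

theorem kraw_contiguity_lower (d : ℕ) (hd : 1 ≤ d) (σ σs ρ : ℂ)
    (hρ : ρ ≠ 0) (hσσs : σ * σs ≠ ρ)
    (x i : ℕ) (hx : x ≤ d - 1) (hi : i ≤ d - 1) :
    krawP d σ σs ρ x (i : ℤ) =
      krawP (d - 1) σ σs ρ x (i : ℤ) +
        ρ / (σ * σs - ρ) * krawP (d - 1) σ σs ρ x ((i : ℤ) - 1) := by
  obtain ⟨n, rfl⟩ : ∃ n, d = n + 1 := ⟨d - 1, by omega⟩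
  simp only [Nat.add_sub_cancel] at hx hi ⊢
  rw [krawP_natCast _ _ _ i (by omega : x ≤ n + 1), krawP_natCast _ _ _ i hx]
  cases i with
  | zero => simp [krawP]
  | succ j =>
    rw [show ((j + 1 : ℕ) : ℤ) - 1 = (j : ℤ) by push_cast; ring, krawP_natCast _ _ _ j hx,
      ← mul_assoc, ← pow_succ', ← mul_add, ← Finset.sum_add_distrib]
    congr 1
    refine Finset.sum_congr rfl fun k hk => ?_
    rw [← add_mul]
    congr 1
    simp only [Finset.mem_range] at hk
    rcases lt_trichotomy k (j + 1) with h | rfl | h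
    · rw [if_pos h.le, if_pos h.le, if_pos (by omega), Nat.sub_add_comm (by omega : k ≤ n),
        Nat.sub_add_comm (by omega : k ≤ j), Nat.choose_succ_succ']
      push_cast
      ring
    · simp
    · rw [if_neg (by omega), if_neg (by omega), if_neg (by omega), add_zero]
end

section
/- Fix an integer d ≥ 1 and nonzero complex parameters q, ρ, σ* such that q^m ≠ 1 for all integers 1 ≤ m ≤ d, ρ q^m ≠ 1 for all integers 1 ≤ m ≤ d, σ* q^m ≠ 1 for all integers 1 ≤ m ≤ 2d + 2, and σ* q^m ≠ ρ for all integers 1 ≤ m ≤ d + 1. Then for all integers 0 ≤ x ≤ d − 1 and 0 ≤ i ≤ d − 1, the following contiguity relation for the normalized q-Hahn functions holds: (q(ρ − qσ*)/(1 − q²σ*)) · p_{x,i}(d; ρ, σ*; q) = (q^{i+1}(ρ − σ* q^{i+1})/(1 − σ* q^{2i+2})) · p_{x,i}(d−1; ρ, σ* q; q) + ((1 − ρ q^{i})/(1 − σ* q^{2i})) · p_{x,i−1}(d−1; ρ, σ* q; q). -/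
/-- q-Pochhammer symbol `(a;q)_k`. -/
noncomputable def qpoch (a q : ℂ) (k : ℕ) : ℂ := ∏ l ∈ Finset.range k, (1 - a * q ^ l)

/-- q-binomial coefficient `[n choose i]_q` (set to `0` when `i > n`). -/
noncomputable def qbinom (q : ℂ) (n i : ℕ) : ℂ :=
  if i ≤ n then qpoch q q n / (qpoch q q i * qpoch q q (n - i)) else 0

/-- Normalized q-Hahn function `p_{x,i}(d; ρ, σ*; q)`, with the convention that it
vanishes for negative `i`. -/
noncomputable def qHahnP (d : ℕ) (ρ σs q : ℂ) (x : ℕ) (i : ℤ) : ℂ :=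
  if i < 0 then 0
  else
    qbinom q d i.toNat * qpoch (q * ρ) q i.toNat * qpoch (q ^ 2 * σs) q d /
        ((q * ρ) ^ i.toNat * qpoch (q * σs / ρ) q i.toNat *
          qpoch (σs * q ^ (i.toNat + 1)) q i.toNat *
          qpoch (σs * q ^ (2 * i.toNat + 2)) q (d - i.toNat)) *
      ∑ k ∈ Finset.range (min i.toNat x + 1),
        qpoch (q ^ (-(i.toNat : ℤ))) q k * qpoch (σs * q ^ (i.toNat + 1)) q k *
            qpoch (q ^ (-(x : ℤ))) q k * q ^ k /
          (qpoch (ρ * q) q k * qpoch (q ^ (-(d : ℤ))) q k * qpoch q q k)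

theorem qpoch_succ (a q : ℂ) (k : ℕ) : qpoch a q (k + 1) = qpoch a q k * (1 - a * q ^ k) :=
  Finset.prod_range_succ _ _

theorem qpoch_succ' (a q : ℂ) (k : ℕ) : qpoch a q (k + 1) = (1 - a) * qpoch (a * q) q k := by
  simp only [qpoch, Finset.prod_range_succ', pow_zero, mul_one, pow_succ']
  rw [mul_comm]
  simp only [mul_assoc]

theorem qpoch_shift (a q : ℂ) (k : ℕ) :
    (1 - a) * qpoch (a * q) q k = qpoch a q k * (1 - a * q ^ k) := by
  rw [← qpoch_succ', qpoch_succ]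

theorem qpoch_ne_zero {a q : ℂ} {k : ℕ} (h : ∀ l < k, a * q ^ l ≠ 1) : qpoch a q k ≠ 0 :=
  Finset.prod_ne_zero_iff.mpr fun l hl => sub_ne_zero.mpr (h l (Finset.mem_range.mp hl)).symm

theorem qpoch_inv_pow_eq_zero {q : ℂ} (hq : q ≠ 0) {i k : ℕ} (h : i < k) :
    qpoch (q ^ (-(i : ℤ))) q k = 0 :=
  Finset.prod_eq_zero (Finset.mem_range.mpr h) (by simp [hq])

theorem inv_pow_mul_pow_ne_one {q : ℂ} (hq : q ≠ 0) {n l : ℕ} (hl : l < n)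
    (h : q ^ (n - l) ≠ 1) : q ^ (-(n : ℤ)) * q ^ l ≠ 1 := by
  intro e
  apply h
  rw [zpow_neg, zpow_natCast, inv_mul_eq_one₀ (pow_ne_zero _ hq)] at e
  rw [pow_sub₀ q hq hl.le, e, mul_inv_cancel₀ (pow_ne_zero _ hq)]

/-- The summand of the basic hypergeometric series defining the q-Hahn functions. -/
noncomputable def qHahnTerm (d : ℕ) (ρ σs q : ℂ) (x i k : ℕ) : ℂ :=
  qpoch (q ^ (-(i : ℤ))) q k * qpoch (σs * q ^ (i + 1)) q k *
      qpoch (q ^ (-(x : ℤ))) q k * q ^ k /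
    (qpoch (ρ * q) q k * qpoch (q ^ (-(d : ℤ))) q k * qpoch q q k)

/-- The factor in front of the series defining the q-Hahn functions. -/
noncomputable def qHahnCoeff (d : ℕ) (ρ σs q : ℂ) (i : ℕ) : ℂ :=
  qbinom q d i * qpoch (q * ρ) q i * qpoch (q ^ 2 * σs) q d /
    ((q * ρ) ^ i * qpoch (q * σs / ρ) q i * qpoch (σs * q ^ (i + 1)) q i *
      qpoch (σs * q ^ (2 * i + 2)) q (d - i))

theorem qHahnP_eq {q : ℂ} (hq : q ≠ 0) (d : ℕ) (ρ σs : ℂ) (x i : ℕ) :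
    qHahnP d ρ σs q x (i : ℤ) =
      qHahnCoeff d ρ σs q i * ∑ k ∈ Finset.range (x + 1), qHahnTerm d ρ σs q x i k := by
  have h : ¬ ((i : ℤ) < 0) := by omega
  simp only [qHahnP, if_neg h, Int.toNat_natCast, qHahnCoeff, qHahnTerm]
  congr 1
  apply Finset.sum_subset
  · intro k hk
    simp only [Finset.mem_range] at *
    omega
  · intro k hk hk'
    simp only [Finset.mem_range] at *
    rw [qpoch_inv_pow_eq_zero hq (by omega : i < k)]
    simp

theorem qHahnTerm_contiguity {d : ℕ} {q : ℂ} (ρ σs : ℂ) (hq : q ≠ 0)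
    (hq1 : ∀ m : ℕ, 1 ≤ m → m ≤ d + 1 → q ^ m ≠ 1)
    {j k : ℕ} (x : ℕ) (hj : j < d) (hk : k ≤ d)
    (hσi : σs * q ^ (j + 2) ≠ 1) :
    (1 - q ^ (d + 1)) * (1 - σs * q ^ (2 * j + 3)) * qHahnTerm (d + 1) ρ σs q x (j + 1) k =
      (q ^ (j + 1) - q ^ (d + 1)) * (1 - σs * q ^ (j + 2)) *
          qHahnTerm d ρ (σs * q) q x (j + 1) k +
        (1 - q ^ (j + 1)) * (1 - σs * q ^ (d + j + 3)) * qHahnTerm d ρ (σs * q) q x j k := by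
  have e1 := qpoch_shift (q ^ (-((j + 1 : ℕ) : ℤ))) q k
  have e2 := qpoch_shift (σs * q ^ (j + 1 + 1)) q k
  have e3 := qpoch_shift (q ^ (-((d + 1 : ℕ) : ℤ))) q k
  have s (n : ℕ) : q ^ (-((n + 1 : ℕ) : ℤ)) * q = q ^ (-(n : ℤ)) := by
    rw [← zpow_add_one₀ hq]
    congr 1
    push_cast
    ring
  rw [s] at e1 e3
  have n1 : 1 - q ^ (-((j + 1 : ℕ) : ℤ)) ≠ 0 := by
    have := inv_pow_mul_pow_ne_one hq (Nat.succ_pos j) (hq1 (j + 1) (by omega) (by omega))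
    rw [pow_zero, mul_one] at this
    exact sub_ne_zero.mpr this.symm
  have n3 : 1 - q ^ (-((d + 1 : ℕ) : ℤ)) ≠ 0 := by
    have := inv_pow_mul_pow_ne_one hq (Nat.succ_pos d) (hq1 (d + 1) (by omega) (by omega))
    rw [pow_zero, mul_one] at this
    exact sub_ne_zero.mpr this.symm
  have n2 : 1 - σs * q ^ (j + 1 + 1) ≠ 0 := sub_ne_zero.mpr hσi.symm
  have n4 : 1 - q ^ (-((d + 1 : ℕ) : ℤ)) * q ^ k ≠ 0 :=
    sub_ne_zero.mpr (inv_pow_mul_pow_ne_one hq (by omega) (hq1 _ (by omega) (by omega))).symm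
  have nD : qpoch (q ^ (-((d + 1 : ℕ) : ℤ))) q k ≠ 0 :=
    qpoch_ne_zero fun l hl => inv_pow_mul_pow_ne_one hq (by omega) (hq1 _ (by omega) (by omega))
  rw [mul_comm, ← eq_div_iff n1] at e1
  rw [mul_comm, ← eq_div_iff n2] at e2
  rw [mul_comm, ← eq_div_iff n3] at e3
  have a1 : σs * q * q ^ (j + 1 + 1) = σs * q ^ (j + 1 + 1) * q := by ring
  have a2 : σs * q * q ^ (j + 1) = σs * q ^ (j + 1 + 1) := by ring
  simp only [qHahnTerm, a1, a2, e1, e2, e3]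
  generalize qpoch (q ^ (-((j + 1 : ℕ) : ℤ))) q k = P1
  generalize qpoch (σs * q ^ (j + 1 + 1)) q k = P2
  generalize qpoch (q ^ (-((d + 1 : ℕ) : ℤ))) q k = D at *
  have key : (1 - q ^ (d + 1)) * (1 - σs * q ^ (2 * j + 3)) *
      ((1 - q ^ (-((d + 1 : ℕ) : ℤ)) * q ^ k) * (1 - q ^ (-((j + 1 : ℕ) : ℤ)))) =
      (1 - q ^ (-((d + 1 : ℕ) : ℤ))) *
      ((q ^ (j + 1) - q ^ (d + 1)) * (1 - σs * q ^ (j + 2) * q ^ k) *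
        (1 - q ^ (-((j + 1 : ℕ) : ℤ))) +
       (1 - q ^ (j + 1)) * (1 - σs * q ^ (d + j + 3)) *
        (1 - q ^ (-((j + 1 : ℕ) : ℤ)) * q ^ k)) := by
    simp only [zpow_neg, zpow_natCast]
    field_simp
    ring
  generalize q ^ (-((j + 1 : ℕ) : ℤ)) = u at *
  generalize q ^ (-((d + 1 : ℕ) : ℤ)) = v at *
  generalize qpoch (q ^ (-(x : ℤ))) q k = X
  have key' : (1 - q ^ (d + 1)) * (1 - σs * q ^ (2 * j + 3)) = (1 - v) *
      ((q ^ (j + 1) - q ^ (d + 1)) * (1 - σs * q ^ (j + 2) * q ^ k) * (1 - u) +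
       (1 - q ^ (j + 1)) * (1 - σs * q ^ (d + j + 3)) * (1 - u * q ^ k)) /
        ((1 - v * q ^ k) * (1 - u)) := by
    rw [eq_div_iff (mul_ne_zero n4 n1), key]
  rw [key']
  by_cases h0 : qpoch (ρ * q) q k * qpoch q q k = 0
  · rcases mul_eq_zero.mp h0 with h | h <;> simp [h]
  obtain ⟨h1, h2⟩ := mul_ne_zero_iff.mp h0
  generalize qpoch (ρ * q) q k = R at *
  generalize qpoch q q k = Q at *
  have m2 : 1 - σs * q ^ (j + 2) ≠ 0 := n2
  generalize q ^ k = Y at *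
  simp only [show j + 1 + 1 = j + 2 from rfl]
  generalize q ^ (j + 2) = J at *
  generalize q ^ (j + 1) = J' at *
  generalize q ^ (d + 1) = K at *
  generalize q ^ (d + j + 3) = L at *
  field_simp

set_option maxHeartbeats 1000000 in
theorem qHahnCoeff_contiguity {d i : ℕ} {q ρ σs : ℂ} (hρ0 : ρ ≠ 0)
    (hq1 : ∀ m : ℕ, 1 ≤ m → m ≤ d + 1 → q ^ m ≠ 1)
    (hσ : ∀ m : ℕ, 1 ≤ m → m ≤ 2 * d + 4 → σs * q ^ m ≠ 1)
    (hσρ : ∀ m : ℕ, 1 ≤ m → m ≤ d + 2 → σs * q ^ m ≠ ρ) (hi : i ≤ d) :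
    q ^ (i + 1) * (ρ - σs * q ^ (i + 1)) / (1 - σs * q ^ (2 * i + 2)) *
        qHahnCoeff d ρ (σs * q) q i * ((1 - q ^ (d + 1)) * (1 - σs * q ^ (2 * i + 1))) =
      q * (ρ - q * σs) / (1 - q ^ 2 * σs) * qHahnCoeff (d + 1) ρ σs q i *
        ((q ^ i - q ^ (d + 1)) * (1 - σs * q ^ (i + 1))) := by
  obtain ⟨e, rfl⟩ := Nat.exists_eq_add_of_le hi
  have nσ (m : ℕ) (h1 : 1 ≤ m) (h2 : m ≤ 2 * (i + e) + 4) : 1 - σs * q ^ m ≠ 0 :=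
    sub_ne_zero.mpr (hσ m h1 h2).symm
  have nq (m : ℕ) (h1 : 1 ≤ m) (h2 : m ≤ i + e + 1) : 1 - q ^ m ≠ 0 :=
    sub_ne_zero.mpr (hq1 m h1 h2).symm
  have n2 : 1 - q ^ 2 * σs ≠ 0 := by
    rw [mul_comm]
    exact nσ 2 (by omega) (by omega)
  have nρ (m : ℕ) (h1 : 1 ≤ m) (h2 : m ≤ i + e + 2) : 1 - q ^ m * σs / ρ ≠ 0 := by
    rw [sub_ne_zero, ne_comm, Ne, div_eq_one_iff_eq hρ0, mul_comm]
    exact hσρ m h1 h2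
  have b1 : qpoch q q (i + e + 1) = qpoch q q (i + e) * (1 - q ^ (i + e + 1)) := by
    rw [qpoch_succ, pow_succ' q (i + e)]
  have b2 : qpoch q q (e + 1) = qpoch q q e * (1 - q ^ (e + 1)) := by
    rw [qpoch_succ, pow_succ' q e]
  have b3 := qpoch_succ' (q ^ 2 * σs) q (i + e)
  have b4 := qpoch_shift (q * σs / ρ) q i
  have b5 := qpoch_shift (σs * q ^ (i + 1)) q i
  have b6 := qpoch_succ' (σs * q ^ (2 * i + 2)) q e
  have b4' : q * σs / ρ * q ^ i = q ^ (i + 1) * σs / ρ := by ring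
  have b5' : σs * q ^ (i + 1) * q ^ i = σs * q ^ (2 * i + 1) := by ring
  have n4 : 1 - q * σs / ρ ≠ 0 := by simpa using nρ 1 le_rfl (by omega)
  rw [b4', mul_comm, ← eq_div_iff n4] at b4
  rw [b5', mul_comm, ← eq_div_iff (nσ _ (by omega) (by omega))] at b5
  have c1 : q * (σs * q) / ρ = q * σs / ρ * q := by ring
  have c2 : σs * q * q ^ (i + 1) = σs * q ^ (i + 1) * q := by ring
  have c3 : σs * q * q ^ (2 * i + 2) = σs * q ^ (2 * i + 2) * q := by ring
  have c4 : q ^ 2 * (σs * q) = q ^ 2 * σs * q := by ring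
  have z1 : qpoch (q * σs / ρ) q i ≠ 0 := by
    refine qpoch_ne_zero fun l hl h => nρ (l + 1) (by omega) (by omega) ?_
    rw [← h]
    ring
  have m1 := nρ (i + 1) (by omega) (by omega)
  have m2 := nσ (2 * i + 2) (by omega) (by omega)
  have m3 := nσ (2 * i + 1) (by omega) (by omega)
  have m4 := nσ (i + 1) (by omega) (by omega)
  have m5 := nq (i + e + 1) (by omega) (by omega)
  have m6 := nq (e + 1) (by omega) (by omega)
  have t1 : ρ - σs * q ^ (i + 1) = ρ * (1 - q ^ (i + 1) * σs / ρ) := by field_simp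
  have t2 : ρ - q * σs = ρ * (1 - q * σs / ρ) := by field_simp
  have t3 : q ^ i - q ^ (i + e + 1) = q ^ i * (1 - q ^ (e + 1)) := by ring
  simp only [qHahnCoeff, qbinom, if_pos (show i ≤ i + e by omega),
    if_pos (show i ≤ i + e + 1 by omega), show i + e + 1 - i = e + 1 by omega,
    Nat.add_sub_cancel_left, c1, c2, c3, c4, b1, b2, b3, b4, b5, b6, t1, t2, t3]
  generalize 1 - q ^ (i + 1) * σs / ρ = g1 at *
  generalize 1 - q * σs / ρ = g2 at *
  generalize 1 - q ^ (e + 1) = g3 at *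
  generalize 1 - q ^ (i + e + 1) = g4 at *
  generalize 1 - σs * q ^ (i + 1) = g5 at *
  generalize 1 - σs * q ^ (2 * i + 1) = g6 at *
  generalize 1 - σs * q ^ (2 * i + 2) = g7 at *
  generalize 1 - q ^ 2 * σs = g8 at *
  rw [pow_succ' q i]
  field_simp

theorem qHahnCoeff_pred_contiguity {d j : ℕ} {q ρ σs : ℂ} (hq : q ≠ 0) (hρ0 : ρ ≠ 0)
    (hq1 : ∀ m : ℕ, 1 ≤ m → m ≤ d + 1 → q ^ m ≠ 1)
    (hσ : ∀ m : ℕ, 1 ≤ m → m ≤ 2 * d + 4 → σs * q ^ m ≠ 1)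
    (hσρ : ∀ m : ℕ, 1 ≤ m → m ≤ d + 2 → σs * q ^ m ≠ ρ) (hj : j + 1 ≤ d) :
    (1 - ρ * q ^ (j + 1)) / (1 - σs * q ^ (2 * (j + 1))) *
        qHahnCoeff d ρ (σs * q) q j * ((1 - q ^ (d + 1)) * (1 - σs * q ^ (2 * j + 3))) =
      q * (ρ - q * σs) / (1 - q ^ 2 * σs) * qHahnCoeff (d + 1) ρ σs q (j + 1) *
        ((1 - q ^ (j + 1)) * (1 - σs * q ^ (d + j + 3))) := by
  obtain ⟨e, rfl⟩ := Nat.exists_eq_add_of_le hj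
  have nσ (m : ℕ) (h1 : 1 ≤ m) (h2 : m ≤ 2 * (j + 1 + e) + 4) : 1 - σs * q ^ m ≠ 0 :=
    sub_ne_zero.mpr (hσ m h1 h2).symm
  have nq (m : ℕ) (h1 : 1 ≤ m) (h2 : m ≤ j + 1 + e + 1) : 1 - q ^ m ≠ 0 :=
    sub_ne_zero.mpr (hq1 m h1 h2).symm
  have n2 : 1 - q ^ 2 * σs ≠ 0 := by
    rw [mul_comm]
    exact nσ 2 (by omega) (by omega)
  have n4 : 1 - q * σs / ρ ≠ 0 := by
    rw [sub_ne_zero, ne_comm, Ne, div_eq_one_iff_eq hρ0, mul_comm]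
    simpa using hσρ 1 le_rfl (by omega)
  have b1 : qpoch q q (j + 1 + e + 1) = qpoch q q (j + 1 + e) * (1 - q ^ (j + 1 + e + 1)) := by
    rw [qpoch_succ, pow_succ' q (j + 1 + e)]
  have b2 : qpoch q q (j + 1) = qpoch q q j * (1 - q ^ (j + 1)) := by
    rw [qpoch_succ, pow_succ' q j]
  have b3 := qpoch_succ' (q ^ 2 * σs) q (j + 1 + e)
  have b4 := qpoch_succ' (q * σs / ρ) q j
  have b5 : qpoch (σs * q ^ (j + 1 + 1)) q (j + 1) =
      qpoch (σs * q ^ (j + 1 + 1)) q j * (1 - σs * q ^ (2 * (j + 1))) := by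
    rw [qpoch_succ]
    ring
  have b6 := qpoch_shift (σs * q ^ (2 * j + 3)) q (e + 1)
  have b7 : qpoch (q * ρ) q (j + 1) = qpoch (q * ρ) q j * (1 - ρ * q ^ (j + 1)) := by
    rw [qpoch_succ]
    ring
  have b6' : σs * q ^ (2 * j + 3) * q ^ (e + 1) = σs * q ^ (j + 1 + e + j + 3) := by ring
  rw [b6', mul_comm, ← eq_div_iff (nσ _ (by omega) (by omega))] at b6
  have c1 : q * (σs * q) / ρ = q * σs / ρ * q := by ring
  have c2 : σs * q * q ^ (j + 1) = σs * q ^ (j + 1 + 1) := by ring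
  have c3 : σs * q * q ^ (2 * j + 2) = σs * q ^ (2 * j + 3) := by ring
  have c3' : σs * q ^ (2 * (j + 1) + 2) = σs * q ^ (2 * j + 3) * q := by ring
  have c4 : q ^ 2 * (σs * q) = q ^ 2 * σs * q := by ring
  have z1 : qpoch (σs * q ^ (2 * j + 3)) q (e + 1) ≠ 0 := by
    refine qpoch_ne_zero fun l hl h => hσ (2 * j + 3 + l) (by omega) (by omega) ?_
    rw [← h]
    ring
  have m2 := nσ (2 * (j + 1)) (by omega) (by omega)
  have m3 := nσ (2 * j + 3) (by omega) (by omega)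
  have m4 := nσ (j + 1 + e + j + 3) (by omega) (by omega)
  have m5 := nq (j + 1 + e + 1) (by omega) (by omega)
  have m6 := nq (j + 1) (by omega) (by omega)
  have t2 : ρ - q * σs = ρ * (1 - q * σs / ρ) := by field_simp
  simp only [qHahnCoeff, qbinom, if_pos (show j ≤ j + 1 + e by omega),
    if_pos (show j + 1 ≤ j + 1 + e + 1 by omega), show j + 1 + e + 1 - (j + 1) = e + 1 by omega,
    show j + 1 + e - j = e + 1 by omega, c1, c2, c3, c3', c4, b1, b2, b3, b4, b5, b6, b7, t2]
  generalize 1 - q * σs / ρ = g2 at *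
  generalize 1 - q ^ (j + 1) = g3 at *
  generalize 1 - q ^ (j + 1 + e + 1) = g4 at *
  generalize 1 - ρ * q ^ (j + 1) = g5 at *
  generalize 1 - σs * q ^ (2 * (j + 1)) = g6 at *
  generalize 1 - σs * q ^ (2 * j + 3) = g7 at *
  generalize 1 - σs * q ^ (j + 1 + e + j + 3) = g9 at *
  generalize 1 - q ^ 2 * σs = g8 at *
  rw [pow_succ (q * ρ) j]
  field_simp

theorem qHahn_contiguity_lower (d : ℕ) (hd : 1 ≤ d) (q ρ σs : ℂ)
    (hq : q ≠ 0) (hρ0 : ρ ≠ 0) (hσs0 : σs ≠ 0)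
    (hq1 : ∀ m : ℕ, 1 ≤ m → m ≤ d → q ^ m ≠ 1)
    (hρ : ∀ m : ℕ, 1 ≤ m → m ≤ d → ρ * q ^ m ≠ 1)
    (hσ : ∀ m : ℕ, 1 ≤ m → m ≤ 2 * d + 2 → σs * q ^ m ≠ 1)
    (hσρ : ∀ m : ℕ, 1 ≤ m → m ≤ d + 1 → σs * q ^ m ≠ ρ)
    (x i : ℕ) (hx : x ≤ d - 1) (hi : i ≤ d - 1) :
    q * (ρ - q * σs) / (1 - q ^ 2 * σs) * qHahnP d ρ σs q x (i : ℤ) =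
      q ^ (i + 1) * (ρ - σs * q ^ (i + 1)) / (1 - σs * q ^ (2 * i + 2)) *
          qHahnP (d - 1) ρ (σs * q) q x (i : ℤ) +
        (1 - ρ * q ^ i) / (1 - σs * q ^ (2 * i)) *
          qHahnP (d - 1) ρ (σs * q) q x ((i : ℤ) - 1) := by
  obtain ⟨d, rfl⟩ := Nat.exists_eq_add_of_le' hd
  rw [Nat.add_sub_cancel] at *
  replace hσ : ∀ m : ℕ, 1 ≤ m → m ≤ 2 * d + 4 → σs * q ^ m ≠ 1 := hσ
  replace hσρ : ∀ m : ℕ, 1 ≤ m → m ≤ d + 2 → σs * q ^ m ≠ ρ := hσρ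
  have hA := qHahnCoeff_contiguity hρ0 hq1 hσ hσρ hi
  have nd : 1 - q ^ (d + 1) ≠ 0 := sub_ne_zero.mpr (hq1 _ (by omega) le_rfl).symm
  have nσ (m : ℕ) (h1 : 1 ≤ m) (h2 : m ≤ 2 * d + 4) : 1 - σs * q ^ m ≠ 0 :=
    sub_ne_zero.mpr (hσ m h1 h2).symm
  rw [qHahnP_eq hq, qHahnP_eq hq]
  rcases i with _ | j
  · have hsum (D : ℕ) (s : ℂ) :
        ∑ k ∈ Finset.range (x + 1), qHahnTerm D ρ s q x 0 k = 1 := by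
      rw [Finset.sum_eq_single 0]
      · simp [qHahnTerm, qpoch]
      · intro k _ hk
        simp only [qHahnTerm, qpoch_inv_pow_eq_zero hq (Nat.pos_of_ne_zero hk), zero_mul, zero_div]
      · simp
    have hP : qHahnP d ρ (σs * q) q x (((0 : ℕ) : ℤ) - 1) = 0 := if_pos (by norm_num)
    have n1 := nσ (0 + 1) (by omega) (by omega)
    rw [hP, hsum, hsum]
    simp only [mul_zero, add_zero, mul_one] at hA ⊢
    refine mul_right_cancel₀ (mul_ne_zero nd n1) ?_
    rw [hA]
    simp
  · have hB := qHahnCoeff_pred_contiguity hq hρ0 hq1 hσ hσρ hi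
    have hcast : ((j + 1 : ℕ) : ℤ) - 1 = (j : ℤ) := by push_cast; ring
    rw [hcast, qHahnP_eq hq]
    have n1 := nσ (2 * j + 3) (by omega) (by omega)
    have hS : (1 - q ^ (d + 1)) * (1 - σs * q ^ (2 * j + 3)) *
          ∑ k ∈ Finset.range (x + 1), qHahnTerm (d + 1) ρ σs q x (j + 1) k =
        (q ^ (j + 1) - q ^ (d + 1)) * (1 - σs * q ^ (j + 2)) *
            ∑ k ∈ Finset.range (x + 1), qHahnTerm d ρ (σs * q) q x (j + 1) k +
          (1 - q ^ (j + 1)) * (1 - σs * q ^ (d + j + 3)) *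
            ∑ k ∈ Finset.range (x + 1), qHahnTerm d ρ (σs * q) q x j k := by
      simp only [Finset.mul_sum, ← Finset.sum_add_distrib]
      refine Finset.sum_congr rfl fun k hk => ?_
      have := Finset.mem_range.mp hk
      exact qHahnTerm_contiguity ρ σs hq hq1 x (by omega) (by omega)
        (hσ _ (by omega) (by omega))
    refine mul_right_cancel₀ (mul_ne_zero nd n1) ?_
    rw [show 2 * (j + 1) + 1 = 2 * j + 3 by ring] at hA
    linear_combination (q * (ρ - q * σs) / (1 - q ^ 2 * σs) *
        qHahnCoeff (d + 1) ρ σs q (j + 1)) * hS -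
      (∑ k ∈ Finset.range (x + 1), qHahnTerm d ρ (σs * q) q x (j + 1) k) * hA -
      (∑ k ∈ Finset.range (x + 1), qHahnTerm d ρ (σs * q) q x j k) * hB
end

section
/- Fix an integer d ≥ 1 and nonzero complex parameters q, ρ, σ such that q^m ≠ 1 for all integers 1 ≤ m ≤ d, ρ q^m ≠ 1 for all integers 1 ≤ m ≤ d, and ρ ≠ σ q^m for all integers 1 ≤ m ≤ d. Then for all integers 0 ≤ x ≤ d − 1 and 0 ≤ i ≤ d − 1, the following contiguity relation for the normalized dual q-Hahn functions holds: q(ρ − σ q^{d}) · p_{x,i}(d; ρ, σ; q) = q(ρ q^{i} − σ q^{d}) · p_{x,i}(d−1; ρ, σ; q) + (1 − ρ q^{i}) · p_{x,i−1}(d−1; ρ, σ; q). -/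
/-- Normalized dual q-Hahn function `p_{x,i}(d; ρ, σ; q)`, with the convention that it
vanishes for negative `i`. -/
noncomputable def dualQHahnP (d : ℕ) (ρ σ q : ℂ) (x : ℕ) (i : ℤ) : ℂ :=
  if i < 0 then 0
  else
    (-1 : ℂ) ^ i.toNat * q ^ (((i.toNat : ℤ) * ((i.toNat : ℤ) - 3 - 2 * (d : ℤ))) / 2) *
        qbinom q d i.toNat * qpoch (q * ρ) q i.toNat /
        (σ ^ i.toNat * qpoch (q ^ (-(d : ℤ)) * ρ / σ) q i.toNat) *
      ∑ k ∈ Finset.range (min i.toNat x + 1),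
        qpoch (q ^ (-(i.toNat : ℤ))) q k * qpoch (q ^ (-(x : ℤ))) q k *
            qpoch (σ * q ^ (x + 1)) q k * q ^ k /
          (qpoch (ρ * q) q k * qpoch (q ^ (-(d : ℤ))) q k * qpoch q q k)

/-- Shifting the base point of a `q`-Pochhammer symbol. -/
theorem qpoch_mul_one_sub (a q : ℂ) (k : ℕ) :
    qpoch a q k * (1 - a * q ^ k) = (1 - a) * qpoch (a * q) q k := by
  rw [← qpoch_succ, qpoch_succ']

theorem qpoch_zpow_neg_shift {q : ℂ} (hq : q ≠ 0) (n k : ℕ) :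
    qpoch (q ^ (-((n + 1 : ℕ) : ℤ))) q k * (q ^ (n + 1) - q ^ k) =
      (q ^ (n + 1) - 1) * qpoch (q ^ (-(n : ℤ))) q k := by
  have h := qpoch_mul_one_sub (q ^ (-((n + 1 : ℕ) : ℤ))) q k
  have e : q ^ (-((n + 1 : ℕ) : ℤ)) * q = q ^ (-(n : ℤ)) := by
    rw [← zpow_add_one₀ hq]; congr 1; push_cast; ring
  have e' : q ^ (n + 1) * q ^ (-((n + 1 : ℕ) : ℤ)) = 1 := by
    rw [zpow_neg, zpow_natCast]; exact mul_inv_cancel₀ (pow_ne_zero _ hq)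
  rw [e] at h
  linear_combination q ^ (n + 1) * h +
    (qpoch (q ^ (-((n + 1 : ℕ) : ℤ))) q k * q ^ k - qpoch (q ^ (-(n : ℤ))) q k) * e'

theorem qpoch_zpow_neg_self {q : ℂ} (hq : q ≠ 0) (n : ℕ) :
    qpoch (q ^ (-(n : ℤ))) q (n + 1) = 0 := by
  rw [qpoch_succ, zpow_neg, zpow_natCast, inv_mul_cancel₀ (pow_ne_zero _ hq), sub_self, mul_zero]

/-- The factor of `dualQHahnP` in front of the terminating sum. -/
noncomputable def dualQHahnCoeff (d : ℕ) (ρ σ q : ℂ) (i : ℕ) : ℂ :=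
  (-1 : ℂ) ^ i * q ^ (((i : ℤ) * ((i : ℤ) - 3 - 2 * (d : ℤ))) / 2) *
    qbinom q d i * qpoch (q * ρ) q i / (σ ^ i * qpoch (q ^ (-(d : ℤ)) * ρ / σ) q i)

/-- The part of the `k`-th summand of `dualQHahnP` which depends neither on `d` nor on `i`. -/
noncomputable def dualQHahnBasis (ρ σ q : ℂ) (x k : ℕ) : ℂ :=
  qpoch (q ^ (-(x : ℤ))) q k * qpoch (σ * q ^ (x + 1)) q k * q ^ k /
    (qpoch (ρ * q) q k * qpoch q q k)

theorem dualQHahnP_natCast (d : ℕ) (ρ σ q : ℂ) (x i : ℕ) :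
    dualQHahnP d ρ σ q x (i : ℤ) = ∑ k ∈ Finset.range (min i x + 1),
      dualQHahnCoeff d ρ σ q i * (qpoch (q ^ (-(i : ℤ))) q k / qpoch (q ^ (-(d : ℤ))) q k) *
        dualQHahnBasis ρ σ q x k := by
  rw [dualQHahnP, if_neg (by lia)]
  simp only [Int.toNat_natCast]
  rw [← dualQHahnCoeff, Finset.mul_sum]
  refine Finset.sum_congr rfl fun k _ => ?_
  rw [dualQHahnBasis]
  simp only [div_eq_mul_inv, mul_inv]
  ring

theorem sum_range_min_succ_dualQHahn {q : ℂ} (hq : q ≠ 0) (j x : ℕ) (f : ℕ → ℂ) (c g : ℕ → ℂ) :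
    ∑ k ∈ Finset.range (min j x + 1), c k * (qpoch (q ^ (-(j : ℤ))) q k / f k) * g k =
      ∑ k ∈ Finset.range (min (j + 1) x + 1),
        c k * (qpoch (q ^ (-(j : ℤ))) q k / f k) * g k := by
  rcases le_or_gt x j with h | h
  · rw [min_eq_right h, min_eq_right (by lia)]
  · rw [min_eq_left h.le, min_eq_left (by lia), Finset.sum_range_succ _ (j + 1),
      qpoch_zpow_neg_self hq]
    simp

theorem qbinom_succ_left_mul {q : ℂ} {n i : ℕ} (hq1 : ∀ m : ℕ, 1 ≤ m → m ≤ i + n + 1 → q ^ m ≠ 1) :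
    qbinom q (i + n + 1) i * (1 - q ^ (n + 1)) = qbinom q (i + n) i * (1 - q ^ (i + n + 1)) := by
  have h (r : ℕ) (hr : r ≤ i + n + 1) : qpoch q q r ≠ 0 :=
    qpoch_ne_zero fun l hl => by rw [← pow_succ']; exact hq1 _ (by lia) (by lia)
  have h1 := h i (by lia)
  have h2 := h n (by lia)
  have h3 := h (n + 1) (by lia)
  rw [qbinom, qbinom, if_pos (by lia), if_pos (by lia), show i + n + 1 - i = n + 1 by lia,
    show i + n - i = n by lia]
  rw [qpoch_succ] at h3
  rw [qpoch_succ q q n, qpoch_succ q q (i + n)]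
  have h4 := right_ne_zero_of_mul h3
  field_simp
  ring

theorem qbinom_succ_right_mul {q : ℂ} {n j : ℕ} (hq1 : ∀ m : ℕ, 1 ≤ m → m ≤ j + n + 1 → q ^ m ≠ 1) :
    qbinom q (j + n + 1) (j + 1) * (1 - q ^ (j + 1)) =
      qbinom q (j + n + 1) j * (1 - q ^ (n + 1)) := by
  have h (r : ℕ) (hr : r ≤ j + n + 1) : qpoch q q r ≠ 0 :=
    qpoch_ne_zero fun l hl => by rw [← pow_succ']; exact hq1 _ (by lia) (by lia)
  have h1 := h j (by lia)
  have h2 := h n (by lia)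
  have h3 := h (n + 1) (by lia)
  have h4 := h (j + 1) (by lia)
  rw [qbinom, qbinom, if_pos (by lia), if_pos (by lia), show j + n + 1 - j = n + 1 by lia,
    show j + n + 1 - (j + 1) = n by lia]
  rw [qpoch_succ] at h3 h4
  rw [qpoch_succ q q n, qpoch_succ q q j]
  have h5 := right_ne_zero_of_mul h3
  have h6 := right_ne_zero_of_mul h4
  field_simp
  ring

theorem qpoch_zpow_neg_mul_div_ne_zero {q ρ σ : ℂ} (hq : q ≠ 0) (hσ0 : σ ≠ 0) {d i : ℕ}
    (hi : i ≤ d) (hρσ : ∀ m : ℕ, 1 ≤ m → m ≤ d → ρ ≠ σ * q ^ m) :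
    qpoch (q ^ (-(d : ℤ)) * ρ / σ) q i ≠ 0 := by
  refine qpoch_ne_zero fun l hl h => hρσ (d - l) (by lia) (by lia) ?_
  have e : q ^ d = q ^ (d - l) * q ^ l := by rw [← pow_add]; congr 1; lia
  rw [zpow_neg, zpow_natCast, e] at h
  field_simp at h
  linear_combination h

/-- Contiguity of the coefficient in `d`. -/
theorem dualQHahnCoeff_succ_left {q ρ σ : ℂ} (hq : q ≠ 0) (hσ0 : σ ≠ 0) {n i : ℕ}
    (hq1 : ∀ m : ℕ, 1 ≤ m → m ≤ i + n + 1 → q ^ m ≠ 1)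
    (hρσ : ∀ m : ℕ, 1 ≤ m → m ≤ i + n + 1 → ρ ≠ σ * q ^ m) :
    dualQHahnCoeff (i + n + 1) ρ σ q i * (q ^ i * (1 - q ^ (n + 1)) * (ρ - σ * q ^ (i + n + 1))) =
      dualQHahnCoeff (i + n) ρ σ q i *
        ((1 - q ^ (i + n + 1)) * (ρ * q ^ i - σ * q ^ (i + n + 1))) := by
  have hb := qbinom_succ_left_mul hq1
  have h1 := qpoch_zpow_neg_mul_div_ne_zero hq hσ0 (i := i) (by lia) hρσ
  have h2 := qpoch_zpow_neg_mul_div_ne_zero hq hσ0 (d := i + n) (i := i) (by lia)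
    fun m h h' => hρσ m h (by lia)
  have hs := qpoch_mul_one_sub (q ^ (-((i + n + 1 : ℕ) : ℤ)) * ρ / σ) q i
  have e : q ^ (-((i + n + 1 : ℕ) : ℤ)) * ρ / σ * q = q ^ (-((i + n : ℕ) : ℤ)) * ρ / σ := by
    rw [show (-((i + n : ℕ) : ℤ)) = -((i + n + 1 : ℕ) : ℤ) + 1 by push_cast; ring,
      zpow_add_one₀ hq]
    ring
  have hz : q ^ (((i : ℤ) * ((i : ℤ) - 3 - 2 * ((i + n : ℕ) : ℤ))) / 2) =
      q ^ (((i : ℤ) * ((i : ℤ) - 3 - 2 * ((i + n + 1 : ℕ) : ℤ))) / 2) * q ^ i := by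
    rw [← zpow_natCast, ← zpow_add₀ hq, ← Int.add_mul_ediv_right _ _ (by norm_num)]
    congr 2; push_cast; ring
  rw [e] at hs
  simp only [dualQHahnCoeff]
  rw [hz]
  generalize qpoch (q ^ (-((i + n : ℕ) : ℤ)) * ρ / σ) q i = P at *
  generalize qpoch (q ^ (-((i + n + 1 : ℕ) : ℤ)) * ρ / σ) q i = R at *
  generalize q ^ (((i : ℤ) * ((i : ℤ) - 3 - 2 * ((i + n + 1 : ℕ) : ℤ))) / 2) = Z
  rw [zpow_neg, zpow_natCast] at hs
  have hD : q ^ (i + n + 1) ≠ 0 := pow_ne_zero _ hq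
  generalize q ^ (i + n + 1) = D at *
  field_simp at hs ⊢
  generalize qbinom q (i + n + 1) i = b at *
  generalize qbinom q (i + n) i = b' at *
  linear_combination qpoch (ρ * q) q i * Z * (P * (ρ - D * σ) * hb + (1 - D) * b' * hs)

/-- Contiguity of the coefficient in `i`. -/
theorem dualQHahnCoeff_succ_right {q ρ σ : ℂ} (hq : q ≠ 0) (hσ0 : σ ≠ 0) {n j : ℕ}
    (hq1 : ∀ m : ℕ, 1 ≤ m → m ≤ j + n + 1 → q ^ m ≠ 1)
    (hρσ : ∀ m : ℕ, 1 ≤ m → m ≤ j + n + 1 → ρ ≠ σ * q ^ m) :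
    dualQHahnCoeff (j + n + 1) ρ σ q (j + 1) *
        (q * (1 - q ^ (j + 1)) * (ρ * q ^ (j + 1) - σ * q ^ (j + n + 2))) =
      dualQHahnCoeff (j + n + 1) ρ σ q j *
        (q ^ (j + 1) * (1 - q ^ (n + 1)) * (1 - ρ * q ^ (j + 1))) := by
  have hb := qbinom_succ_right_mul hq1
  have h1 := qpoch_zpow_neg_mul_div_ne_zero hq hσ0 (i := j + 1) (by lia) hρσ
  have hz : q ^ ((((j + 1 : ℕ) : ℤ) * (((j + 1 : ℕ) : ℤ) - 3 - 2 * ((j + n + 1 : ℕ) : ℤ))) / 2) *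
      q ^ (n + 2) = q ^ (((j : ℤ) * ((j : ℤ) - 3 - 2 * ((j + n + 1 : ℕ) : ℤ))) / 2) := by
    rw [← zpow_natCast, ← zpow_add₀ hq, ← Int.add_mul_ediv_right _ _ (by norm_num)]
    congr 2; push_cast; ring
  simp only [dualQHahnCoeff]
  rw [← hz]
  rw [qpoch_succ] at h1 ⊢
  rw [qpoch_succ]
  have h2 := left_ne_zero_of_mul h1
  have h3 := right_ne_zero_of_mul h1
  generalize qpoch (q ^ (-((j + n + 1 : ℕ) : ℤ)) * ρ / σ) q j = P at *
  generalize q ^ ((((j + 1 : ℕ) : ℤ) * (((j + 1 : ℕ) : ℤ) - 3 - 2 * ((j + n + 1 : ℕ) : ℤ))) / 2) = Z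
  generalize qbinom q (j + n + 1) (j + 1) = b at *
  generalize qbinom q (j + n + 1) j = b' at *
  have hF : ρ * q ^ (j + 1) - σ * q ^ (j + n + 2) =
      -(σ * q ^ (j + n + 2)) * (1 - q ^ (-((j + n + 1 : ℕ) : ℤ)) * ρ / σ * q ^ j) := by
    rw [zpow_neg, zpow_natCast]
    field_simp
    ring
  rw [hF]
  generalize 1 - q ^ (-((j + n + 1 : ℕ) : ℤ)) * ρ / σ * q ^ j = F at *
  field_simp
  linear_combination (-1 : ℂ) ^ j * q ^ (j + n + 3) * (1 - ρ * q ^ (j + 1)) *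
    (Z * qpoch (q * ρ) q j * σ * σ ^ j) * hb

theorem dualQHahn_contiguity_lower (d : ℕ) (hd : 1 ≤ d) (q ρ σ : ℂ)
    (hq : q ≠ 0) (hρ0 : ρ ≠ 0) (hσ0 : σ ≠ 0)
    (hq1 : ∀ m : ℕ, 1 ≤ m → m ≤ d → q ^ m ≠ 1)
    (hρ : ∀ m : ℕ, 1 ≤ m → m ≤ d → ρ * q ^ m ≠ 1)
    (hρσ : ∀ m : ℕ, 1 ≤ m → m ≤ d → ρ ≠ σ * q ^ m)
    (x i : ℕ) (hx : x ≤ d - 1) (hi : i ≤ d - 1) :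
    q * (ρ - σ * q ^ d) * dualQHahnP d ρ σ q x (i : ℤ) =
      q * (ρ * q ^ i - σ * q ^ d) * dualQHahnP (d - 1) ρ σ q x (i : ℤ) +
        (1 - ρ * q ^ i) * dualQHahnP (d - 1) ρ σ q x ((i : ℤ) - 1) := by
  rcases i with _ | j
  · have hq0 : qpoch q q d ≠ 0 :=
      qpoch_ne_zero fun l hl => by rw [← pow_succ']; exact hq1 _ (by lia) (by lia)
    have hq0' : qpoch q q (d - 1) ≠ 0 :=
      qpoch_ne_zero fun l hl => by rw [← pow_succ']; exact hq1 _ (by lia) (by lia)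
    have h0 (a : ℂ) : qpoch a q 0 = 1 := Finset.prod_range_zero _
    simp [dualQHahnP, qbinom, h0, div_self hq0, div_self hq0']
  obtain ⟨n, rfl⟩ : ∃ n, d = j + n + 2 := ⟨d - j - 2, by lia⟩
  rw [show ((j + 1 : ℕ) : ℤ) - 1 = (j : ℤ) by push_cast; ring,
    show j + n + 2 - 1 = j + n + 1 by lia]
  simp only [dualQHahnP_natCast]
  rw [sum_range_min_succ_dualQHahn hq j x _ (fun _ => _), Finset.mul_sum, Finset.mul_sum,
    Finset.mul_sum, ← Finset.sum_add_distrib]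
  refine Finset.sum_congr rfl fun k hk => ?_
  rw [Finset.mem_range] at hk
  have hA := dualQHahnCoeff_succ_left (ρ := ρ) hq hσ0 (n := n) (i := j + 1)
    (fun m h h' => hq1 m h (by lia)) (fun m h h' => hρσ m h (by lia))
  have hB := dualQHahnCoeff_succ_right (ρ := ρ) hq hσ0 (n := n) (j := j)
    (fun m h h' => hq1 m h (by lia)) (fun m h h' => hρσ m h (by lia))
  rw [show j + 1 + n + 1 = j + n + 2 by lia, show j + 1 + n = j + n + 1 by lia] at hA
  have hN := qpoch_zpow_neg_shift hq j k
  have hP := qpoch_zpow_neg_shift hq (j + n + 1) k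
  have hne (r : ℕ) (hr : r ≤ j + n + 2) (hk : k ≤ r) : qpoch (q ^ (-(r : ℤ))) q k ≠ 0 := by
    refine qpoch_ne_zero fun l hl h => hq1 (r - l) (by lia) (by lia) ?_
    have e : q ^ r = q ^ (r - l) * q ^ l := by rw [← pow_add]; congr 1; lia
    rw [zpow_neg, zpow_natCast, e] at h
    field_simp at h
    exact h.symm
  have hP1 := hne (j + n + 1) (by lia) (by lia)
  have hP2 := hne (j + n + 2) (by lia) (by lia)
  have hd1 : q ^ (j + n + 2) - 1 ≠ 0 := sub_ne_zero.2 (hq1 _ (by lia) (by lia))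
  have hj1 : q ^ (j + 1) - 1 ≠ 0 := sub_ne_zero.2 (hq1 _ (by lia) (by lia))
  have hn1 : 1 - q ^ (n + 1) ≠ 0 := sub_ne_zero.2 (hq1 _ (by lia) (by lia)).symm
  have hρσ' : ρ - σ * q ^ (j + n + 2) ≠ 0 := sub_ne_zero.2 (hρσ _ (by lia) (by lia))
  have hj0 : q ^ (j + 1) ≠ 0 := pow_ne_zero _ hq
  have hsplit : q ^ (j + n + 2) = q ^ (j + 1) * q ^ (n + 1) := by ring
  rw [show j + n + 1 + 1 = j + n + 2 by lia] at hP
  generalize qpoch (q ^ (-((j + 1 : ℕ) : ℤ))) q k = M at *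
  generalize qpoch (q ^ (-(j : ℤ))) q k = N at *
  generalize qpoch (q ^ (-((j + n + 1 : ℕ) : ℤ))) q k = P at *
  generalize qpoch (q ^ (-((j + n + 2 : ℕ) : ℤ))) q k = R at *
  generalize dualQHahnCoeff (j + n + 2) ρ σ q (j + 1) = A at *
  generalize dualQHahnCoeff (j + n + 1) ρ σ q (j + 1) = B at *
  generalize dualQHahnCoeff (j + n + 1) ρ σ q j = C at *
  generalize dualQHahnBasis ρ σ q x k = G at *
  generalize q ^ (j + n + 2) = D at *
  generalize q ^ (j + 1) = J at *
  generalize q ^ (n + 1) = m at *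
  generalize q ^ k = K at *
  have hN' : N = M * (J - K) / (J - 1) := by
    rw [eq_div_iff hj1]; linear_combination -hN
  have hP' : P = R * (D - K) / (D - 1) := by
    rw [eq_div_iff hd1]; linear_combination -hP
  have hDK : D - K ≠ 0 := fun h => hP1 (by rw [hP', h]; simp)
  have hAq : (ρ - σ * D) * A = B * (1 - D) * (ρ * J - σ * D) / (J * (1 - m)) := by
    rw [eq_div_iff (mul_ne_zero hj0 hn1)]; linear_combination hA
  have hCq : (1 - ρ * J) * C = B * (q * (1 - J) * (ρ * J - σ * D)) / (J * (1 - m)) := by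
    rw [eq_div_iff (mul_ne_zero hj0 hn1)]; linear_combination -hB
  calc q * (ρ - σ * D) * (A * (M / R) * G) = ((ρ - σ * D) * A) * (q * (M / R) * G) := by ring
    _ = q * (ρ * J - σ * D) * (B * (M / P) * G) + ((1 - ρ * J) * C) * ((N / P) * G) := by
      rw [hAq, hCq, hN', hP']
      field_simp
      subst hsplit
      ring
    _ = _ := by ring
end
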